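/- Let W₁ : 𝒳 → 𝒴 and W₂ : 𝒳 → 𝒵 be discrete memoryless channels with common finite input alphabet 𝒳 of cardinality 2^q, fixed input distribution P_X, and suppose W₂ is degraded with respect to W₁. In the multilevel polar construction with block length N = 2^n, let the index sets 𝓕, 𝓐, 𝓡, 𝓓 be defined from the polarization sets. Then, as n → ∞: |𝓕|/N → H(X|Y), |𝓐|/N → I(X;Y) − I(X;Z), |𝓡|/N → I(X;Z), and |𝓓|/N → q − H(X), where (X,Y) is distributed as P_X followed by W₁ and (X,Z) as P_X followed by W₂. -/

import Mathlib

open scoped BigOperators Classical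
open Filter Topology

noncomputable section

namespace PolarWiretap

variable {Ω α γ 𝒱 : Type*}

/-- Probability mass assigned by the weight function `p` to the value `a`
of the random variable `X` (the distribution of `X`). -/
def dist [Fintype Ω] (p : Ω → ℝ) (X : Ω → α) (a : α) : ℝ :=
  ∑ ω, if X ω = a then p ω else 0

/-- Probability of the event `E` under the weight function `p`. -/
def pr [Fintype Ω] (p : Ω → ℝ) (E : Ω → Prop) : ℝ :=
  ∑ ω, if E ω then p ω else 0

/-- Shannon entropy (in bits) of the random variable `X` under `p`. -/
def H [Fintype Ω] [Fintype α] (p : Ω → ℝ) (X : Ω → α) : ℝ :=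
  ∑ a, -(dist p X a * Real.logb 2 (dist p X a))

/-- Conditional Shannon entropy `H(X|Y) = H(X,Y) − H(Y)` (in bits). -/
def condH [Fintype Ω] [Fintype α] [Fintype γ] (p : Ω → ℝ) (X : Ω → α) (Y : Ω → γ) : ℝ :=
  H p (fun ω => (X ω, Y ω)) - H p Y

/-- Mutual information `I(X;Y) = H(X) + H(Y) − H(X,Y)` (in bits). -/
def MI [Fintype Ω] [Fintype α] [Fintype γ] (p : Ω → ℝ) (X : Ω → α) (Y : Ω → γ) : ℝ :=
  H p X + H p Y - H p (fun ω => (X ω, Y ω))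

/-- Bhattacharyya parameter
`Z_B(T|V) = 2 ∑_v √(P_{T,V}(0,v) · P_{T,V}(1,v))` of a binary random variable `T`
given the side information `V`. -/
def ZB [Fintype Ω] [Fintype 𝒱] (p : Ω → ℝ) (T : Ω → ZMod 2) (V : Ω → 𝒱) : ℝ :=
  2 * ∑ v, Real.sqrt (dist p (fun ω => (T ω, V ω)) (0, v) *
      dist p (fun ω => (T ω, V ω)) (1, v))

/-- `p` is a probability mass function on the finite type `Ω`. -/
def IsPMF [Fintype Ω] (p : Ω → ℝ) : Prop := (∀ ω, 0 ≤ p ω) ∧ ∑ ω, p ω = 1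

/-- `W` is a (discrete memoryless) channel: a stochastic matrix. -/
def IsChannel {𝒳 𝒴 : Type*} [Fintype 𝒴] (W : 𝒳 → 𝒴 → ℝ) : Prop :=
  (∀ x y, 0 ≤ W x y) ∧ ∀ x, ∑ y, W x y = 1

/-- `W₂` is degraded with respect to `W₁` (`W₂ ⪯ W₁`): there is a channel `W̃`
with `W₂(z|x) = ∑_y W₁(y|x)·W̃(z|y)`. -/
def Degraded {𝒳 𝒴 𝒵 : Type*} [Fintype 𝒴] [Fintype 𝒵]
    (W₂ : 𝒳 → 𝒵 → ℝ) (W₁ : 𝒳 → 𝒴 → ℝ) : Prop :=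
  ∃ Wt : 𝒴 → 𝒵 → ℝ, IsChannel Wt ∧ ∀ x z, W₂ x z = ∑ y, W₁ x y * Wt y z

/-- The binary entropy function `h₂(x) = −x log₂ x − (1−x) log₂ (1−x)`. -/
def h2 (x : ℝ) : ℝ := -(x * Real.logb 2 x) - (1 - x) * Real.logb 2 (1 - x)

/-- The single-letter joint distribution of an input `X ~ P_X` and the output of
the channel `W` fed with `X`: `P(x,y) = P_X(x)·W(y|x)`. -/
def slP {𝒳 𝒴 : Type*} (PX : 𝒳 → ℝ) (W : 𝒳 → 𝒴 → ℝ) : 𝒳 × 𝒴 → ℝ :=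
  fun a => PX a.1 * W a.1 a.2


/-- Entry `(i,j)` of the polar generator matrix `G_N = B_N · G^{⊗n}` over `𝔽₂`,
where `G = [[1,0],[1,1]]`, `G^{⊗n}` is the `n`-th Kronecker power and `B_N` the
bit-reversal permutation (`N = 2^n`). -/
def GN (n : ℕ) (i j : Fin (2 ^ n)) : ZMod 2 :=
  if ∀ k < n, Nat.testBit j.val k → Nat.testBit i.val (n - 1 - k) then 1 else 0

variable {𝒳 𝒴 𝒵 : Type*}

/-- The i.i.d. distribution `P(x) = ∏_i P_X(x_i)` of `N = 2^n` input symbols. -/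
def codeX [Fintype 𝒳] (PX : 𝒳 → ℝ) (n : ℕ) : (Fin (2 ^ n) → 𝒳) → ℝ :=
  fun x => ∏ i, PX (x i)

/-- The joint distribution of `N = 2^n` i.i.d. inputs `X_i ∼ P_X` together with
the outputs of `N` independent uses of the channel `W`. -/
def codeP [Fintype 𝒳] [Fintype 𝒴] (PX : 𝒳 → ℝ) (W : 𝒳 → 𝒴 → ℝ) (n : ℕ) :
    ((Fin (2 ^ n) → 𝒳) × (Fin (2 ^ n) → 𝒴)) → ℝ :=
  fun ω => (∏ i, PX (ω.1 i)) * ∏ i, W (ω.1 i) (ω.2 i)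

/-- The `l`-th label bit `B_j^l` of the `j`-th symbol, via the bit labeling `f`. -/
def Bbit {q : ℕ} (f : (Fin q → ZMod 2) ≃ 𝒳) (n : ℕ) (x : Fin (2 ^ n) → 𝒳)
    (j : Fin (2 ^ n)) (l : Fin q) : ZMod 2 :=
  f.symm (x j) l

/-- The polar-transformed bit `U_i^l` at level `l`:  `U^l = B^l · G_N`
(recall `G_N` is its own inverse, so this inverts `B^l = U^l · G_N`). -/
def Ubit {q : ℕ} (f : (Fin q → ZMod 2) ≃ 𝒳) (n : ℕ) (x : Fin (2 ^ n) → 𝒳)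
    (l : Fin q) (i : Fin (2 ^ n)) : ZMod 2 :=
  ∑ j, Bbit f n x j l * GN n j i

/-- The value space of the side information
`V_i^l = (U^l_{[i−1]}, B^{[l−1]}_{[N]})`. -/
abbrev VType (q n : ℕ) (l : Fin q) (i : Fin (2 ^ n)) : Type :=
  ({j : Fin (2 ^ n) // j < i} → ZMod 2) × (Fin (2 ^ n) → {k : Fin q // k < l} → ZMod 2)

/-- The side information `V_i^l = (U^l_{[i−1]}, B^{[l−1]}_{[N]})`: the previous
bits of level `l` together with all label bits of the lower levels. -/
def Vval {q : ℕ} (f : (Fin q → ZMod 2) ≃ 𝒳) (n : ℕ) (x : Fin (2 ^ n) → 𝒳)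
    (l : Fin q) (i : Fin (2 ^ n)) : VType q n l i :=
  (fun j => Ubit f n x l j.1, fun j k => Bbit f n x j k.1)

/-- The polarization threshold `δ_N = 2^{−N^β}`, `N = 2^n`. -/
noncomputable def deltaN (β : ℝ) (n : ℕ) : ℝ := (2 : ℝ) ^ (-((2 ^ n : ℝ) ^ β))

/-- The Bhattacharyya parameter `Z_B(U_i^l | V_i^l)` (no channel output). -/
def ZBplain [Fintype 𝒳] {q : ℕ} (PX : 𝒳 → ℝ) (f : (Fin q → ZMod 2) ≃ 𝒳)
    (n : ℕ) (l : Fin q) (i : Fin (2 ^ n)) : ℝ :=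
  ZB (codeX PX n) (fun x => Ubit f n x l i) (fun x => Vval f n x l i)

/-- The Bhattacharyya parameter `Z_B(U_i^l | V_i^l, Y)` with the channel
output vector `Y` of `W` as extra side information. -/
def ZBout [Fintype 𝒳] [Fintype 𝒴] {q : ℕ} (PX : 𝒳 → ℝ) (W : 𝒳 → 𝒴 → ℝ)
    (f : (Fin q → ZMod 2) ≃ 𝒳) (n : ℕ) (l : Fin q) (i : Fin (2 ^ n)) : ℝ :=
  ZB (codeP PX W n) (fun ω => Ubit f n ω.1 l i) (fun ω => (Vval f n ω.1 l i, ω.2))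

/-- `𝓛_X = {(l,i) : Z_B(U_i^l | V_i^l) < δ_N}`. -/
def Lplain [Fintype 𝒳] {q : ℕ} (PX : 𝒳 → ℝ) (f : (Fin q → ZMod 2) ≃ 𝒳)
    (β : ℝ) (n : ℕ) : Set (Fin q × Fin (2 ^ n)) :=
  {a | ZBplain PX f n a.1 a.2 < deltaN β n}

/-- `𝓗_X = {(l,i) : Z_B(U_i^l | V_i^l) > 1 − δ_N}`. -/
def Hplain [Fintype 𝒳] {q : ℕ} (PX : 𝒳 → ℝ) (f : (Fin q → ZMod 2) ≃ 𝒳)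
    (β : ℝ) (n : ℕ) : Set (Fin q × Fin (2 ^ n)) :=
  {a | 1 - deltaN β n < ZBplain PX f n a.1 a.2}

/-- `𝓛_{X|Y} = {(l,i) : Z_B(U_i^l | V_i^l, Y) < δ_N}` (for the channel `W`). -/
def Lout [Fintype 𝒳] [Fintype 𝒴] {q : ℕ} (PX : 𝒳 → ℝ) (W : 𝒳 → 𝒴 → ℝ)
    (f : (Fin q → ZMod 2) ≃ 𝒳) (β : ℝ) (n : ℕ) : Set (Fin q × Fin (2 ^ n)) :=
  {a | ZBout PX W f n a.1 a.2 < deltaN β n}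

/-- `𝓗_{X|Y} = {(l,i) : Z_B(U_i^l | V_i^l, Y) > 1 − δ_N}` (for the channel `W`). -/
def Hout [Fintype 𝒳] [Fintype 𝒴] {q : ℕ} (PX : 𝒳 → ℝ) (W : 𝒳 → 𝒴 → ℝ)
    (f : (Fin q → ZMod 2) ≃ 𝒳) (β : ℝ) (n : ℕ) : Set (Fin q × Fin (2 ^ n)) :=
  {a | 1 - deltaN β n < ZBout PX W f n a.1 a.2}


/-- The frozen-bit index set `𝓕 = (𝓛_{X|Y})^C`. -/
def Fset [Fintype 𝒳] [Fintype 𝒴] {q : ℕ} (PX : 𝒳 → ℝ) (W₁ : 𝒳 → 𝒴 → ℝ)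
    (f : (Fin q → ZMod 2) ≃ 𝒳) (β : ℝ) (n : ℕ) : Set (Fin q × Fin (2 ^ n)) :=
  (Lout PX W₁ f β n)ᶜ

/-- The random-bit index set `𝓡 = 𝓛_{X|Z} ∩ 𝓗_X`. -/
def Rset [Fintype 𝒳] [Fintype 𝒵] {q : ℕ} (PX : 𝒳 → ℝ) (W₂ : 𝒳 → 𝒵 → ℝ)
    (f : (Fin q → ZMod 2) ≃ 𝒳) (β : ℝ) (n : ℕ) : Set (Fin q × Fin (2 ^ n)) :=
  Lout PX W₂ f β n ∩ Hplain PX f β n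

/-- The message-bit index set `𝓐 = (𝓛_{X|Y} ∩ 𝓗_X) \ (𝓛_{X|Z} ∩ 𝓗_X)`. -/
def Aset [Fintype 𝒳] [Fintype 𝒴] [Fintype 𝒵] {q : ℕ} (PX : 𝒳 → ℝ)
    (W₁ : 𝒳 → 𝒴 → ℝ) (W₂ : 𝒳 → 𝒵 → ℝ)
    (f : (Fin q → ZMod 2) ≃ 𝒳) (β : ℝ) (n : ℕ) : Set (Fin q × Fin (2 ^ n)) :=
  (Lout PX W₁ f β n ∩ Hplain PX f β n) \ (Lout PX W₂ f β n ∩ Hplain PX f β n)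

/-- The shaping-bit index set `𝓓 = 𝓛_{X|Y} ∩ (𝓗_X)^C`. -/
def Dset [Fintype 𝒳] [Fintype 𝒴] {q : ℕ} (PX : 𝒳 → ℝ) (W₁ : 𝒳 → 𝒴 → ℝ)
    (f : (Fin q → ZMod 2) ≃ 𝒳) (β : ℝ) (n : ℕ) : Set (Fin q × Fin (2 ^ n)) :=
  Lout PX W₁ f β n ∩ (Hplain PX f β n)ᶜ

/-! ### Abstract polarization on a binary tree -/

/-- average over level `n` -/
def Ev (n : ℕ) (f : ℕ → ℝ) : ℝ := (∑ i ∈ Finset.range (2 ^ n), f i) / 2 ^ n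

lemma sum_range_two_mul' (f : ℕ → ℝ) (N : ℕ) :
    ∑ i ∈ Finset.range (2 * N), f i = ∑ i ∈ Finset.range N, (f (2 * i) + f (2 * i + 1)) := by
  induction N with
  | zero => simp
  | succ N ih =>
    rw [Finset.sum_range_succ, ← ih, show 2 * (N + 1) = 2 * N + 1 + 1 by ring,
      Finset.sum_range_succ, Finset.sum_range_succ]
    ring

lemma Ev_succ (n : ℕ) (f : ℕ → ℝ) :
    Ev (n + 1) f = Ev n (fun i => (f (2 * i) + f (2 * i + 1)) / 2) := by
  unfold Ev
  rw [pow_succ', sum_range_two_mul', ← Finset.sum_div, pow_succ', div_div]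

lemma Ev_mono (n : ℕ) (f g : ℕ → ℝ) (h : ∀ i, f i ≤ g i) : Ev n f ≤ Ev n g := by
  unfold Ev
  exact div_le_div_of_nonneg_right (Finset.sum_le_sum fun i _ => h i) (by positivity)

lemma Ev_add (n : ℕ) (f g : ℕ → ℝ) : Ev n (fun i => f i + g i) = Ev n f + Ev n g := by
  unfold Ev
  rw [Finset.sum_add_distrib, add_div]

lemma Ev_const_mul (n : ℕ) (c : ℝ) (f : ℕ → ℝ) : Ev n (fun i => c * f i) = c * Ev n f := by
  unfold Ev
  rw [← Finset.mul_sum, mul_div_assoc]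

lemma Ev_const (n : ℕ) (c : ℝ) : Ev n (fun _ => c) = c := by
  unfold Ev
  simp

/-- the potential -/
def psi (s z : ℝ) : ℝ := if z ≤ 0 then 0 else (-(Real.log z)) ^ (-s)

lemma psi_nonneg {s z : ℝ} (hz1 : z ≤ 1) : 0 ≤ psi s z := by
  unfold psi
  split_ifs with h
  · exact le_rfl
  · push Not at h
    have := Real.log_nonpos h.le hz1
    exact Real.rpow_nonneg (by linarith) _

lemma psi_le_one {s z : ℝ} (hs : 0 < s) (hz1 : z ≤ Real.exp (-1)) : psi s z ≤ 1 := by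
  unfold psi
  split_ifs with h
  · norm_num
  · push Not at h
    have : Real.log z ≤ -1 := by
      rw [Real.log_le_iff_le_exp h]; exact hz1
    exact Real.rpow_le_one_of_one_le_of_nonpos (by linarith) (by linarith)

lemma psi_sq {s z z' : ℝ} (hs : 0 < s) (hz : 0 ≤ z) (hz1 : z ≤ Real.exp (-1))
    (hz' : z' ≤ z ^ 2) : psi s z' ≤ (2 : ℝ) ^ (-s) * psi s z := by
  have hexp : Real.exp (-1) ≤ 1 := by simp
  unfold psi
  split_ifs with h h2 h2
  · simp
  · push Not at h2
    have : Real.log z ≤ -1 := by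
      rw [Real.log_le_iff_le_exp h2]; exact hz1
    have := Real.rpow_nonneg (show 0 ≤ -Real.log z by linarith) (-s)
    positivity
  · have : z = 0 := le_antisymm h2 hz
    subst this
    exact absurd (by simpa using hz') h
  · push Not at h h2
    have h3 : Real.log z ≤ -1 := by
      rw [Real.log_le_iff_le_exp h2]; exact hz1
    have h4 : Real.log z' ≤ 2 * Real.log z := by
      have := Real.log_le_log h hz'
      rwa [Real.log_pow] at this
    rw [← Real.mul_rpow (by norm_num) (by linarith)]
    exact Real.rpow_le_rpow_of_nonpos (by linarith) (by linarith) (by linarith)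

lemma psi_two {s z z' ε η : ℝ} (hs : 0 < s) (hz : 0 ≤ z) (hη : 0 < η) (hη1 : η < 1)
    (hηε : (2 : ℝ) ^ (-ε) ≤ 1 - η)
    (hz1 : z ≤ Real.exp (-(1 / η)))
    (hz' : z' ≤ 2 * z) : psi s z' ≤ (2 : ℝ) ^ (ε * s) * psi s z := by
  have h1η : 1 < 1 / η := by rw [lt_div_iff₀ hη]; linarith
  unfold psi
  split_ifs with h h2 h2
  · simp
  · push Not at h2
    have : Real.log z ≤ -(1 / η) := by
      rw [Real.log_le_iff_le_exp h2]; exact hz1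
    have := Real.rpow_nonneg (show 0 ≤ -Real.log z by linarith) (-s)
    positivity
  · have : z = 0 := le_antisymm h2 hz
    subst this
    exact absurd (by simpa using hz') h
  · push Not at h h2
    have h3 : Real.log z ≤ -(1 / η) := by
      rw [Real.log_le_iff_le_exp h2]; exact hz1
    have h4 : Real.log z' ≤ Real.log 2 + Real.log z := by
      have := Real.log_le_log h hz'
      rwa [Real.log_mul (by norm_num) h2.ne'] at this
    have hl2 : Real.log 2 < 1 := by linarith [Real.log_two_lt_d9]
    have h5 : 1 ≤ η * (-Real.log z) := by
      have : η * (1 / η) ≤ η * (-Real.log z) := mul_le_mul_of_nonneg_left (by linarith) hη.le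
      rwa [mul_one_div_cancel hη.ne'] at this
    have h6 : (2 : ℝ) ^ (ε * s) = ((2 : ℝ) ^ (-ε)) ^ (-s) := by
      rw [← Real.rpow_mul (by norm_num)]; ring_nf
    have h7 : (0 : ℝ) < 2 ^ (-ε) := by positivity
    have h8 : (2 : ℝ) ^ (-ε) * (-Real.log z) ≤ (1 - η) * (-Real.log z) :=
      mul_le_mul_of_nonneg_right hηε (by linarith)
    rw [h6, ← Real.mul_rpow h7.le (by linarith)]
    refine Real.rpow_le_rpow_of_nonpos (mul_pos h7 (by linarith)) ?_ (by linarith)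
    nlinarith

lemma psi_large {s z x : ℝ} (hs : 0 < s) (hx : 0 < x) (hz1 : z ≤ Real.exp (-1))
    (hz : (2 : ℝ) ^ (-x) ≤ z) : x ^ (-s) ≤ psi s z := by
  have h0 : (0 : ℝ) < 2 ^ (-x) := by positivity
  have hzp : 0 < z := lt_of_lt_of_le h0 hz
  unfold psi
  rw [if_neg (not_le.2 hzp)]
  have h3 : Real.log z ≤ -1 := by
    rw [Real.log_le_iff_le_exp hzp]; exact hz1
  have h4 := Real.log_le_log h0 hz
  rw [Real.log_rpow (by norm_num)] at h4
  have hl2 : Real.log 2 < 1 := by linarith [Real.log_two_lt_d9]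
  refine Real.rpow_le_rpow_of_nonpos (by linarith) ?_ (by linarith)
  nlinarith

lemma exists_consts (β : ℝ) (hβ0 : 0 < β) (hβ : β < 1 / 2) :
    ∃ s ε : ℝ, 0 < s ∧ 0 < ε ∧
      (2 : ℝ) ^ (β * s) * (((2 : ℝ) ^ (-s) + (2 : ℝ) ^ (ε * s)) / 2) < 1 := by
  have hl2 : 0 < Real.log 2 := Real.log_pos (by norm_num)
  set ε := (1 / 2 - β) / 2 with hε
  have hε0 : 0 < ε := by rw [hε]; linarith
  have hε1 : ε < 1 / 4 := by rw [hε]; linarith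
  refine ⟨ε / Real.log 2, ε, by positivity, hε0, ?_⟩
  have key : ∀ u : ℝ, (2 : ℝ) ^ (u * (ε / Real.log 2)) = Real.exp (u * ε) := by
    intro u
    rw [Real.rpow_def_of_pos (by norm_num)]
    congr 1
    field_simp
  have k2 := key (-1)
  rw [neg_one_mul] at k2
  rw [key, k2, key, mul_div_assoc', mul_add, ← Real.exp_add, ← Real.exp_add]
  have e1 := Real.abs_exp_sub_one_sub_id_le (x := β * ε + -1 * ε) (by
    rw [abs_le]; constructor <;> nlinarith)
  have e2 := Real.abs_exp_sub_one_sub_id_le (x := β * ε + ε * ε) (by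
    rw [abs_le]; constructor <;> nlinarith)
  have e1' := (abs_le.1 e1).2
  have e2' := (abs_le.1 e2).2
  have hβε : β = 1 / 2 - 2 * ε := by rw [hε]; ring
  have f1 : (β * ε + -1 * ε) ^ 2 ≤ ε ^ 2 := by
    rw [show β * ε + -1 * ε = -(1 - β) * ε by ring, mul_pow]
    have : (-(1 - β)) ^ 2 ≤ 1 := by nlinarith
    nlinarith [sq_nonneg ε]
  have f2 : (β * ε + ε * ε) ^ 2 ≤ ε ^ 2 := by
    rw [show β * ε + ε * ε = (β + ε) * ε by ring, mul_pow]
    have : (β + ε) ^ 2 ≤ 1 := by nlinarith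
    nlinarith [sq_nonneg ε]
  have f3 : (β * ε + -1 * ε) + (β * ε + ε * ε) = -3 * ε ^ 2 := by rw [hβε]; ring
  have : 0 < ε ^ 2 := by positivity
  rw [div_lt_one (by norm_num)]
  linarith

/-- all values from level `m` to level `m+k` along the path are at most `τ` -/
def Gd (z : ℕ → ℕ → ℝ) (τ : ℝ) (m : ℕ) : ℕ → ℕ → Prop
  | 0, i => z m i ≤ τ
  | k + 1, i => Gd z τ m k (i / 2) ∧ z (m + (k + 1)) i ≤ τ

lemma Gd_le {z : ℕ → ℕ → ℝ} {τ : ℝ} {m : ℕ} (k i : ℕ) (h : Gd z τ m k i) : z (m + k) i ≤ τ := by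
  cases k with
  | zero => exact h
  | succ k => exact h.2

/-- hypotheses on one process -/
def OneStep (z : ℕ → ℕ → ℝ) : Prop :=
  ∀ n i, (z (n + 1) (2 * i) ≤ z n i ^ 2 ∧ z (n + 1) (2 * i + 1) ≤ 2 * z n i) ∨
    (z (n + 1) (2 * i + 1) ≤ z n i ^ 2 ∧ z (n + 1) (2 * i) ≤ 2 * z n i)

lemma M_bound (z : ℕ → ℕ → ℝ) (h0 : ∀ n i, 0 ≤ z n i) (h1 : ∀ n i, z n i ≤ 1)
    (hz : OneStep z) {s ε η : ℝ} (hs : 0 < s) (hη : 0 < η) (hη1 : η < 1)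
    (hηε : (2 : ℝ) ^ (-ε) ≤ 1 - η) (m k : ℕ) :
    Ev (m + k) (fun i => if Gd z (Real.exp (-(1 / η))) m k i then psi s (z (m + k) i) else 0) ≤
      (((2 : ℝ) ^ (-s) + (2 : ℝ) ^ (ε * s)) / 2) ^ k := by
  have hτ : Real.exp (-(1 / η)) ≤ Real.exp (-1) := by
    have : 1 < 1 / η := by rw [lt_div_iff₀ hη]; linarith
    exact Real.exp_le_exp.2 (by linarith)
  induction k with
  | zero =>
    rw [pow_zero]
    refine (Ev_mono _ _ (fun _ => 1) ?_).trans (Ev_const _ 1).le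
    intro i
    split_ifs with h
    · exact psi_le_one hs ((Gd_le 0 i h).trans hτ)
    · norm_num
  | succ k ih =>
    rw [← add_assoc, Ev_succ]
    have hκ : 0 ≤ ((2 : ℝ) ^ (-s) + (2 : ℝ) ^ (ε * s)) / 2 := by positivity
    rw [pow_succ']
    refine le_trans ?_ (mul_le_mul_of_nonneg_left ih hκ)
    rw [← Ev_const_mul]
    apply Ev_mono
    intro i
    have hA : ∀ c, c < 2 → (if Gd z (Real.exp (-(1 / η))) m (k + 1) (2 * i + c) then
        psi s (z (m + k + 1) (2 * i + c)) else 0) ≤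
        if Gd z (Real.exp (-(1 / η))) m k i then psi s (z (m + k + 1) (2 * i + c)) else 0 := by
      intro c hc
      have e : (2 * i + c) / 2 = i := by omega
      by_cases h : Gd z (Real.exp (-(1 / η))) m (k + 1) (2 * i + c)
      · rw [if_pos h]
        have := h.1
        rw [e] at this
        rw [if_pos this]
      · rw [if_neg h]
        split_ifs
        · exact psi_nonneg (h1 _ _)
        · exact le_rfl
    have hA0 := hA 0 (by norm_num)
    have hA1 := hA 1 (by norm_num)
    rw [add_zero] at hA0
    refine le_trans (div_le_div_of_nonneg_right (add_le_add hA0 hA1) (by norm_num)) ?_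
    by_cases h : Gd z (Real.exp (-(1 / η))) m k i
    · simp only [if_pos h]
      have hzτ := Gd_le k i h
      rcases hz (m + k) i with ⟨ha, hb⟩ | ⟨ha, hb⟩
      · have := psi_sq hs (h0 _ _) (hzτ.trans hτ) ha
        have := psi_two hs (h0 _ _) hη hη1 hηε hzτ hb
        linarith
      · have := psi_sq hs (h0 _ _) (hzτ.trans hτ) ha
        have := psi_two hs (h0 _ _) hη hη1 hηε hzτ hb
        linarith
    · simp only [if_neg h]; norm_num

/-- hypotheses on a pair of processes -/
structure PolPair (z t : ℕ → ℕ → ℝ) : Prop where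
  z0 : ∀ n i, 0 ≤ z n i
  t0 : ∀ n i, 0 ≤ t n i
  sq : ∀ n i, z n i ^ 2 + t n i ^ 2 ≤ 1
  add : ∀ n i, 1 ≤ z n i + t n i
  zp : ∀ n i, z (n + 1) (2 * i + 1) = z n i ^ 2
  zm : ∀ n i, z (n + 1) (2 * i) ≤ 2 * z n i - z n i ^ 2
  tm : ∀ n i, t (n + 1) (2 * i) = t n i ^ 2
  tp : ∀ n i, t (n + 1) (2 * i + 1) ≤ 2 * t n i - t n i ^ 2

lemma contraction_real {z t : ℝ} (hz : 0 ≤ z) (ht : 0 ≤ t) (h : z ^ 2 + t ^ 2 ≤ 1) :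
    Real.sqrt ((2 - z) * t) + Real.sqrt (z * (2 - t)) ≤ 2 * 0.97 := by
  have hz1 : z ≤ 1 := by nlinarith
  have ht1 : t ≤ 1 := by nlinarith
  have ha : 0 ≤ (2 - z) * t := mul_nonneg (by linarith) ht
  have hb : 0 ≤ z * (2 - t) := mul_nonneg hz (by linarith)
  have sa := Real.sq_sqrt ha
  have sb := Real.sq_sqrt hb
  have na := Real.sqrt_nonneg ((2 - z) * t)
  have nb := Real.sqrt_nonneg (z * (2 - t))
  set x := Real.sqrt ((2 - z) * t)
  set y := Real.sqrt (z * (2 - t))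
  have hp : z * t ≤ 1 / 2 := by nlinarith [sq_nonneg (z - t)]
  have hp0 : 0 ≤ z * t := mul_nonneg hz ht
  have hw : 0 ≤ (1 - z) * (1 - t) := mul_nonneg (by linarith) (by linarith)
  have hr : (x * y) ^ 2 ≤ 3 / 4 + (1 - z) * (1 - t) := by
    rw [mul_pow, sa, sb]
    set w := (1 - z) * (1 - t) with hwd
    set p := z * t with hpd
    have : (2 - z) * t * (z * (2 - t)) = p * (2 - p + 2 * w) := by rw [hwd, hpd]; ring
    rw [this]
    nlinarith
  have hr2 : x * y ≤ ((3 / 4 + (1 - z) * (1 - t)) / 0.9 + 0.9) / 2 := by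
    norm_num
    nlinarith [sq_nonneg (x * y - 9 / 10)]
  have : (x + y) ^ 2 ≤ (2 * 0.97) ^ 2 := by
    have e : (x + y) ^ 2 = (2 - z) * t + z * (2 - t) + 2 * (x * y) := by rw [← sa, ← sb]; ring
    rw [e]
    have : (2 - z) * t + z * (2 - t) = 2 * (1 - (1 - z) * (1 - t)) := by ring
    rw [this]
    norm_num at hr2 ⊢
    linarith
  exact le_of_sq_le_sq this (by norm_num)

lemma PolPair.a_bound {z t : ℕ → ℕ → ℝ} (h : PolPair z t) (n : ℕ) :
    Ev n (fun i => Real.sqrt (z n i * t n i)) ≤ 0.97 ^ n := by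
  have h1 : ∀ n i, z n i ≤ 1 := fun n i => by nlinarith [h.sq n i, h.z0 n i, sq_nonneg (t n i)]
  have h2 : ∀ n i, t n i ≤ 1 := fun n i => by nlinarith [h.sq n i, h.t0 n i, sq_nonneg (z n i)]
  induction n with
  | zero =>
    rw [pow_zero]
    refine (Ev_mono _ _ (fun _ => 1) ?_).trans (Ev_const _ 1).le
    intro i
    refine Real.sqrt_le_one.2 ?_
    nlinarith [h1 0 i, h2 0 i, h.z0 0 i, h.t0 0 i]
  | succ n ih =>
    rw [Ev_succ, pow_succ']
    refine le_trans ?_ (mul_le_mul_of_nonneg_left ih (by norm_num))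
    rw [← Ev_const_mul]
    apply Ev_mono
    intro i
    have hz := h.z0 n i
    have ht := h.t0 n i
    have c := contraction_real hz ht (h.sq n i)
    have p1 : Real.sqrt (z (n + 1) (2 * i) * t (n + 1) (2 * i)) ≤
        Real.sqrt (z n i * t n i) * Real.sqrt ((2 - z n i) * t n i) := by
      rw [← Real.sqrt_mul (mul_nonneg hz ht)]
      apply Real.sqrt_le_sqrt
      rw [h.tm]
      have := mul_le_mul_of_nonneg_right (h.zm n i) (sq_nonneg (t n i))
      nlinarith
    have p2 : Real.sqrt (z (n + 1) (2 * i + 1) * t (n + 1) (2 * i + 1)) ≤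
        Real.sqrt (z n i * t n i) * Real.sqrt (z n i * (2 - t n i)) := by
      rw [← Real.sqrt_mul (mul_nonneg hz ht)]
      apply Real.sqrt_le_sqrt
      rw [h.zp]
      have := mul_le_mul_of_nonneg_left (h.tp n i) (sq_nonneg (z n i))
      nlinarith
    have p3 := mul_le_mul_of_nonneg_left c (Real.sqrt_nonneg (z n i * t n i))
    linarith

lemma PolPair.bad_bound {z t : ℕ → ℕ → ℝ} (h : PolPair z t) {τ : ℝ} (hτ : 0 < τ)
    (hτ4 : τ ≤ 1 / 4) (m k : ℕ) :
    Ev (m + k) (fun i => if ¬ Gd z τ m k i ∧ ¬ Gd t τ m k i then 1 else 0) ≤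
      (∑ j ∈ Finset.range (k + 1), 0.97 ^ (m + j)) / τ := by
  have zle : ∀ n i, z (n + 1) i ≤ 2 * z n (i / 2) := by
    intro n i
    rcases Nat.even_or_odd' i with ⟨j, rfl | rfl⟩
    · rw [show 2 * j / 2 = j by omega]; nlinarith [h.zm n j, sq_nonneg (z n j)]
    · rw [show (2 * j + 1) / 2 = j by omega, h.zp]
      nlinarith [h.sq n j, h.z0 n j, sq_nonneg (t n j)]
  have tle : ∀ n i, t (n + 1) i ≤ 2 * t n (i / 2) := by
    intro n i
    rcases Nat.even_or_odd' i with ⟨j, rfl | rfl⟩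
    · rw [show 2 * j / 2 = j by omega, h.tm]
      nlinarith [h.sq n j, h.t0 n j, sq_nonneg (z n j)]
    · rw [show (2 * j + 1) / 2 = j by omega]; nlinarith [h.tp n j, sq_nonneg (t n j)]
  have big : ∀ n i, τ ≤ z n i → τ ≤ t n i → 1 ≤ (1 / τ) * Real.sqrt (z n i * t n i) := by
    intro n i ha hb
    have : τ ≤ Real.sqrt (z n i * t n i) := Real.le_sqrt_of_sq_le (by nlinarith)
    rw [one_div, inv_mul_eq_div, le_div_iff₀ hτ]
    linarith
  have ipos : (0 : ℝ) ≤ 1 / τ := by positivity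
  induction k with
  | zero =>
    have e : (∑ j ∈ Finset.range (0 + 1), (0.97 : ℝ) ^ (m + j)) / τ = (1 / τ) * 0.97 ^ m := by
      simp; ring
    rw [e]
    refine le_trans ?_ (mul_le_mul_of_nonneg_left (h.a_bound m) ipos)
    rw [← Ev_const_mul]
    apply Ev_mono
    intro i
    split_ifs with hb
    · exact big m i (not_le.1 hb.1).le (not_le.1 hb.2).le
    · exact mul_nonneg ipos (Real.sqrt_nonneg _)
  | succ k ih =>
    rw [Finset.sum_range_succ, add_div]
    have e : (0.97 : ℝ) ^ (m + (k + 1)) / τ = (1 / τ) * 0.97 ^ (m + (k + 1)) := by ring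
    rw [e]
    refine le_trans ?_ (add_le_add ih (mul_le_mul_of_nonneg_left (h.a_bound (m + (k + 1))) ipos))
    have e2 : Ev (m + k) (fun i => if ¬ Gd z τ m k i ∧ ¬ Gd t τ m k i then 1 else 0) =
        Ev (m + (k + 1)) (fun i => if ¬ Gd z τ m k (i / 2) ∧ ¬ Gd t τ m k (i / 2)
          then 1 else 0) := by
      rw [← add_assoc, Ev_succ]
      congr 1
      ext i
      rw [show 2 * i / 2 = i by omega, show (2 * i + 1) / 2 = i by omega]
      ring
    rw [e2, ← Ev_const_mul, ← Ev_add]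
    apply Ev_mono
    intro i
    have spos := mul_nonneg ipos (Real.sqrt_nonneg (z (m + (k + 1)) i * t (m + (k + 1)) i))
    by_cases hb : ¬ Gd z τ m (k + 1) i ∧ ¬ Gd t τ m (k + 1) i
    · rw [if_pos hb]
      by_cases hb' : ¬ Gd z τ m k (i / 2) ∧ ¬ Gd t τ m k (i / 2)
      · rw [if_pos hb']; linarith
      · rw [if_neg hb', zero_add]
        rw [not_and_or, not_not, not_not] at hb'
        have ad := h.add (m + (k + 1)) i
        rcases hb' with g | g
        · have g1 : ¬ (z (m + (k + 1)) i ≤ τ) := fun g2 => hb.1 ⟨g, g2⟩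
          have g3 := Gd_le _ _ g
          have g4 := zle (m + k) i
          rw [← add_assoc] at *
          exact big _ _ (not_le.1 g1).le (by linarith)
        · have g1 : ¬ (t (m + (k + 1)) i ≤ τ) := fun g2 => hb.2 ⟨g, g2⟩
          have g3 := Gd_le _ _ g
          have g4 := tle (m + k) i
          rw [← add_assoc] at *
          exact big _ _ (by linarith) (not_le.1 g1).le
    · rw [if_neg hb]
      split_ifs <;> linarith

lemma geom_bound (m k : ℕ) : ∑ j ∈ Finset.range k, (0.97 : ℝ) ^ (m + j) ≤ 0.97 ^ m * 34 := by
  simp_rw [pow_add]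
  rw [← Finset.mul_sum]
  refine mul_le_mul_of_nonneg_left ?_ (by positivity)
  have := geom_sum_eq (show (0.97 : ℝ) ≠ 1 by norm_num) k
  rw [this]
  have : (0 : ℝ) ≤ 0.97 ^ k := by positivity
  rw [div_le_iff_of_neg (by norm_num)]
  linarith

theorem PolPair.polarize {z t : ℕ → ℕ → ℝ} (h : PolPair z t) (β : ℝ) (hβ0 : 0 < β)
    (hβ : β < 1 / 2) :
    Tendsto (fun n => Ev n (fun i => if deltaN β n ≤ z n i ∧ deltaN β n ≤ t n i then 1 else 0))
      atTop (𝓝 0) := by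
  obtain ⟨s, ε, hs, hε, hθ⟩ := exists_consts β hβ0 hβ
  set κ := ((2 : ℝ) ^ (-s) + (2 : ℝ) ^ (ε * s)) / 2 with hκ
  have hκ0 : 0 < κ := by positivity
  set θ := (2 : ℝ) ^ (β * s) * κ with hθd
  have hθ0 : 0 < θ := by positivity
  have hz1 : ∀ n i, z n i ≤ 1 := fun n i => by nlinarith [h.sq n i, h.z0 n i, sq_nonneg (t n i)]
  have ht1 : ∀ n i, t n i ≤ 1 := fun n i => by nlinarith [h.sq n i, h.t0 n i, sq_nonneg (z n i)]
  -- choose η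
  obtain ⟨η, hη, hη4, hηε⟩ : ∃ η : ℝ, 0 < η ∧ η ≤ 1 / 4 ∧ (2 : ℝ) ^ (-ε) ≤ 1 - η := by
    have : (2 : ℝ) ^ (-ε) < 1 := Real.rpow_lt_one_of_one_lt_of_neg (by norm_num) (by linarith)
    refine ⟨min (1 / 4) (1 - (2 : ℝ) ^ (-ε)), lt_min (by norm_num) (by linarith),
      min_le_left _ _, ?_⟩
    linarith [min_le_right (1 / 4) (1 - (2 : ℝ) ^ (-ε))]
  set τ := Real.exp (-(1 / η)) with hτ
  have hτ0 : 0 < τ := Real.exp_pos _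
  have h4η : 4 ≤ 1 / η := by rw [le_div_iff₀ hη]; linarith
  have hτ1 : τ ≤ Real.exp (-1) := Real.exp_le_exp.2 (by linarith)
  have hτ4 : τ ≤ 1 / 4 := by
    have h5 : 1 / η + 1 ≤ Real.exp (1 / η) := Real.add_one_le_exp _
    rw [hτ, Real.exp_neg, ← one_div]
    exact one_div_le_one_div_of_le (by norm_num) (by linarith)
  have zs : OneStep z := fun n i => Or.inr ⟨(h.zp n i).le, by
    nlinarith [h.zm n i, sq_nonneg (z n i)]⟩
  have ts : OneStep t := fun n i => Or.inl ⟨(h.tm n i).le, by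
    nlinarith [h.tp n i, sq_nonneg (t n i)]⟩
  have main : ∀ m k, Ev (m + k) (fun i => if deltaN β (m + k) ≤ z (m + k) i ∧
      deltaN β (m + k) ≤ t (m + k) i then 1 else 0) ≤
      0.97 ^ m * 34 / τ + 2 * ((2 : ℝ) ^ (β * s)) ^ m * θ ^ k := by
    intro m k
    set n := m + k with hn
    have Mz := M_bound z h.z0 hz1 zs hs hη (by linarith) hηε m k
    have Mt := M_bound t h.t0 ht1 ts hs hη (by linarith) hηε m k
    have B := (h.bad_bound hτ0 hτ4 m k).trans
      (div_le_div_of_nonneg_right (geom_bound m (k + 1)) hτ0.le)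
    rw [← hτ, ← hκ, ← hn] at Mz Mt
    rw [← hn] at B
    set D : ℝ := ((2 : ℝ) ^ (β * s)) ^ n with hD
    have hD0 : 0 < D := by positivity
    have hx0 : (0 : ℝ) < ((2 : ℝ) ^ n) ^ β := by positivity
    have hDx : (((2 : ℝ) ^ n) ^ β) ^ (-s) = D⁻¹ := by
      rw [hD, ← Real.rpow_natCast (2 : ℝ) n, ← Real.rpow_mul (by norm_num),
        ← Real.rpow_mul (by norm_num), ← Real.rpow_natCast, ← Real.rpow_mul (by norm_num),
        ← Real.rpow_neg (by norm_num)]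
      ring_nf
    have pw : ∀ w : ℝ, w ≤ τ → deltaN β n ≤ w → 1 ≤ D * psi s w := by
      intro w hw hd
      have := psi_large hs hx0 (hw.trans hτ1) hd
      rw [hDx] at this
      calc (1 : ℝ) = D * D⁻¹ := (mul_inv_cancel₀ hD0.ne').symm
        _ ≤ _ := mul_le_mul_of_nonneg_left this hD0.le
    have tot : Ev n (fun i => if deltaN β n ≤ z n i ∧ deltaN β n ≤ t n i then 1 else 0) ≤
        Ev n (fun i => if ¬ Gd z τ m k i ∧ ¬ Gd t τ m k i then 1 else 0) +
        (D * Ev n (fun i => if Gd z τ m k i then psi s (z n i) else 0) +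
         D * Ev n (fun i => if Gd t τ m k i then psi s (t n i) else 0)) := by
      rw [← Ev_const_mul, ← Ev_const_mul, ← Ev_add, ← Ev_add]
      apply Ev_mono
      intro i
      have nz : 0 ≤ D * (if Gd z τ m k i then psi s (z n i) else 0) := by
        refine mul_nonneg hD0.le ?_
        split_ifs
        · exact psi_nonneg (hz1 _ _)
        · exact le_rfl
      have nt : 0 ≤ D * (if Gd t τ m k i then psi s (t n i) else 0) := by
        refine mul_nonneg hD0.le ?_
        split_ifs
        · exact psi_nonneg (ht1 _ _)
        · exact le_rfl
      have nb : (0 : ℝ) ≤ if ¬ Gd z τ m k i ∧ ¬ Gd t τ m k i then 1 else 0 := by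
        split_ifs <;> norm_num
      by_cases hc : deltaN β n ≤ z n i ∧ deltaN β n ≤ t n i
      · rw [if_pos hc]
        by_cases gz : Gd z τ m k i
        · rw [if_pos gz] at nz ⊢
          have := pw _ (Gd_le _ _ gz) hc.1
          linarith
        · by_cases gt : Gd t τ m k i
          · rw [if_pos gt] at nt ⊢
            have := pw _ (Gd_le _ _ gt) hc.2
            linarith
          · rw [if_pos ⟨gz, gt⟩]
            linarith
      · rw [if_neg hc]
        linarith
    have e : D * κ ^ k = ((2 : ℝ) ^ (β * s)) ^ m * θ ^ k := by
      rw [hD, hn, pow_add, hθd, mul_pow]; ring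
    have Mz' := mul_le_mul_of_nonneg_left Mz hD0.le
    have Mt' := mul_le_mul_of_nonneg_left Mt hD0.le
    rw [e] at Mz' Mt'
    linarith
  rw [Metric.tendsto_atTop]
  intro e he
  have l1 : Tendsto (fun m : ℕ => (0.97 : ℝ) ^ m * 34 / τ) atTop (𝓝 0) := by
    have := tendsto_pow_atTop_nhds_zero_of_lt_one (r := (0.97 : ℝ)) (by norm_num) (by norm_num)
    simpa using (this.mul_const 34).div_const τ
  obtain ⟨m, hm⟩ := (l1.eventually (gt_mem_nhds (half_pos he))).exists
  have l2 : Tendsto (fun k : ℕ => 2 * ((2 : ℝ) ^ (β * s)) ^ m * θ ^ k) atTop (𝓝 0) := by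
    have := tendsto_pow_atTop_nhds_zero_of_lt_one hθ0.le hθ
    simpa using this.const_mul (2 * ((2 : ℝ) ^ (β * s)) ^ m)
  obtain ⟨K, hK⟩ := (eventually_atTop.1 (l2.eventually (gt_mem_nhds (half_pos he))))
  refine ⟨m + K, fun n hn => ?_⟩
  obtain ⟨k, rfl⟩ : ∃ k, n = m + k := ⟨n - m, by omega⟩
  have h1 := main m k
  have h2 := hK k (by omega)
  have h3 : 0 ≤ Ev (m + k) (fun i => if deltaN β (m + k) ≤ z (m + k) i ∧
      deltaN β (m + k) ≤ t (m + k) i then (1 : ℝ) else 0) := by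
    refine (Ev_const (m + k) 0).ge.trans (Ev_mono _ _ _ ?_)
    intro i
    split_ifs <;> norm_num
  rw [Real.dist_eq, sub_zero, abs_of_nonneg h3]
  linarith

lemma deltaN_pos (β : ℝ) (n : ℕ) : 0 < deltaN β n := by unfold deltaN; positivity

lemma deltaN_le (β : ℝ) (hβ : 0 < β) (n : ℕ) : deltaN β n ≤ 1 / 2 := by
  unfold deltaN
  have h1 : (1 : ℝ) ≤ ((2 : ℝ) ^ n) ^ β :=
    Real.one_le_rpow (one_le_pow₀ (by norm_num)) hβ.le
  calc (2 : ℝ) ^ (-((2 : ℝ) ^ n) ^ β) ≤ (2 : ℝ) ^ (-1 : ℝ) :=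
        Real.rpow_le_rpow_of_exponent_le (by norm_num) (by linarith)
    _ = 1 / 2 := by rw [Real.rpow_neg_one]; norm_num

lemma deltaN_tendsto (β : ℝ) (hβ : 0 < β) : Tendsto (deltaN β) atTop (𝓝 0) := by
  have h1 : Tendsto (fun n : ℕ => ((2 : ℝ) ^ n) ^ β) atTop atTop :=
    (tendsto_rpow_atTop hβ).comp (tendsto_pow_atTop_atTop_of_one_lt (by norm_num))
  have h2 : Tendsto (fun x : ℝ => (2 : ℝ) ^ (-x)) atTop (𝓝 0) := by
    have h3 := tendsto_rpow_atTop_of_base_lt_one (1 / 2 : ℝ) (by norm_num) (by norm_num)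
    refine h3.congr fun x => ?_
    rw [one_div, Real.inv_rpow (by norm_num), Real.rpow_neg (by norm_num)]
  exact h2.comp h1

theorem PolPair.fractions {z t h : ℕ → ℕ → ℝ} (P : PolPair z t) (β : ℝ) (hβ0 : 0 < β)
    (hβ : β < 1 / 2) (h0 C : ℝ) (hC : 0 ≤ C) (hE : ∀ n, Ev n (h n) = h0)
    (hnn : ∀ n i, 0 ≤ h n i)
    (hle : ∀ n i, h n i ≤ 1) (hz : ∀ n i, h n i ≤ C * z n i) (ht : ∀ n i, 1 - t n i ≤ h n i) :
    Tendsto (fun n => Ev n (fun i => if z n i < deltaN β n then 1 else 0)) atTop (𝓝 (1 - h0)) ∧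
    Tendsto (fun n => Ev n (fun i => if 1 - deltaN β n < z n i then 1 else 0)) atTop (𝓝 h0) := by
  have he := P.polarize β hβ0 hβ
  have hδ := deltaN_tendsto β hβ0
  have hδp := deltaN_pos β
  have hδl := deltaN_le β hβ0
  set e : ℕ → ℝ := fun n => Ev n (fun i => if deltaN β n ≤ z n i ∧ deltaN β n ≤ t n i then 1 else 0)
    with hed
  set a : ℕ → ℝ := fun n => Ev n (fun i => if z n i < deltaN β n then 1 else 0) with had
  set c : ℕ → ℝ := fun n => Ev n (fun i => if 1 - deltaN β n < z n i then 1 else 0) with hcd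
  set b : ℕ → ℝ := fun n => Ev n (fun i => if t n i < deltaN β n then 1 else 0) with hbd
  have i1 : ∀ n, 1 ≤ a n + (b n + e n) := by
    intro n
    rw [had, hbd, hed]
    simp only
    rw [← Ev_add, ← Ev_add, ← Ev_const n 1]
    apply Ev_mono
    intro i
    simp only [Ev_const]
    by_cases h1 : z n i < deltaN β n <;> by_cases h2 : t n i < deltaN β n
    · simp [h1, h2, not_le.2 h1, not_le.2 h2]
    · simp [h1, h2, not_le.2 h1]
    · simp [h1, h2, not_le.2 h2]
    · simp [h1, h2, not_lt.1 h1, not_lt.1 h2]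
  have i2 : ∀ n, b n ≤ h0 + deltaN β n := by
    intro n
    rw [← hE n, ← Ev_const n (deltaN β n), ← Ev_add]
    apply Ev_mono
    intro i
    split_ifs with h1
    · linarith [ht n i]
    · linarith [hnn n i, hδp n]
  have i3 : ∀ n, a n + h0 ≤ C * deltaN β n + 1 := by
    intro n
    rw [← hE n, ← Ev_add, ← Ev_const n (C * deltaN β n + 1)]
    apply Ev_mono
    intro i
    split_ifs with h1
    · nlinarith [hz n i]
    · nlinarith [hle n i, hδp n]
  have i4 : ∀ n, b n ≤ c n := by
    intro n
    apply Ev_mono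
    intro i
    by_cases h1 : t n i < deltaN β n
    · have h2 : 1 - deltaN β n < z n i := by linarith [P.add n i]
      simp [h1, h2]
    · rw [if_neg h1]
      split_ifs <;> norm_num
  have i5 : ∀ n, a n + c n ≤ 1 := by
    intro n
    rw [had, hcd]
    simp only
    rw [← Ev_add]
    refine (Ev_mono _ _ (fun _ => 1) ?_).trans (Ev_const _ 1).le
    intro i
    by_cases h1 : z n i < deltaN β n
    · have h2 : ¬ (1 - deltaN β n < z n i) := by linarith [hδl n]
      simp [h1, h2]
    · rw [if_neg h1]
      split_ifs <;> norm_num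
  have A : Tendsto a atTop (𝓝 (1 - h0)) := by
    refine tendsto_of_tendsto_of_tendsto_of_le_of_le
      (g := fun n => 1 - h0 - deltaN β n - e n) (h := fun n => 1 - h0 + C * deltaN β n) ?_ ?_ ?_ ?_
    · simpa using (tendsto_const_nhds (x := 1 - h0)).sub hδ |>.sub he
    · simpa using (tendsto_const_nhds (x := 1 - h0)).add (hδ.const_mul C)
    · intro n; have := i1 n; have := i2 n; simp only; linarith
    · intro n; have := i3 n; simp only; linarith
  refine ⟨A, ?_⟩
  refine tendsto_of_tendsto_of_tendsto_of_le_of_le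
      (g := fun n => 1 - a n - e n) (h := fun n => 1 - a n) ?_ ?_ ?_ ?_
  · simpa using (tendsto_const_nhds (x := (1 : ℝ))).sub A |>.sub he
  · simpa using (tendsto_const_nhds (x := (1 : ℝ))).sub A
  · intro n; have := i1 n; have := i4 n; simp only; linarith
  · intro n; have := i5 n; simp only; linarith

/-! ### One polarization step -/

/-- functional of a joint law -/
def Phi {S : Type*} [Fintype S] (φ : ℝ → ℝ → ℝ) (D : ZMod 2 → S → ℝ) : ℝ := ∑ s, φ (D 0 s) (D 1 s)

def minusD {S : Type*} (D : ZMod 2 → S → ℝ) : ZMod 2 → S × S → ℝ :=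
  fun u st => D u st.1 * D 0 st.2 + D (u + 1) st.1 * D 1 st.2

def plusD {S : Type*} (D : ZMod 2 → S → ℝ) : ZMod 2 → ZMod 2 × (S × S) → ℝ :=
  fun b w => D (w.1 + b) w.2.1 * D b w.2.2

def fZ (a b : ℝ) : ℝ := 2 * Real.sqrt (a * b)
def fT (a b : ℝ) : ℝ := |a - b|
def eta (x : ℝ) : ℝ := -(x * Real.logb 2 x)
def fH (a b : ℝ) : ℝ := eta a + eta b - eta (a + b)
def fS (a b : ℝ) : ℝ := a + b

/-- joint law -/
structure IsLaw {S : Type*} [Fintype S] (D : ZMod 2 → S → ℝ) : Prop where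
  nn : ∀ b s, 0 ≤ D b s
  sum : Phi fS D = 1

lemma zmod2_add : (1 : ZMod 2) + 1 = 0 := by decide

lemma sum_zmod2 (f : ZMod 2 → ℝ) : ∑ b, f b = f 0 + f 1 := Fin.sum_univ_two f

section
variable {S : Type*} [Fintype S] {D : ZMod 2 → S → ℝ}

lemma sum_prod_mul {S' : Type*} [Fintype S'] (f : S → ℝ) (g : S' → ℝ) :
    ∑ st : S × S', f st.1 * g st.2 = (∑ s, f s) * ∑ s, g s := by
  rw [Fintype.sum_prod_type, Finset.sum_mul_sum]

lemma Phi_minus (φ : ℝ → ℝ → ℝ) : Phi φ (minusD D) =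
    ∑ st : S × S, φ (D 0 st.1 * D 0 st.2 + D 1 st.1 * D 1 st.2)
      (D 1 st.1 * D 0 st.2 + D 0 st.1 * D 1 st.2) := by
  simp [Phi, minusD, zmod2_add]

lemma Phi_plus (φ : ℝ → ℝ → ℝ) : Phi φ (plusD D) =
    ∑ st : S × S, (φ (D 0 st.1 * D 0 st.2) (D 1 st.1 * D 1 st.2) +
      φ (D 1 st.1 * D 0 st.2) (D 0 st.1 * D 1 st.2)) := by
  unfold Phi
  rw [Fintype.sum_prod_type, sum_zmod2, ← Finset.sum_add_distrib]
  simp [plusD, zmod2_add]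

lemma Z_plus (h : IsLaw D) : Phi fZ (plusD D) = (Phi fZ D) ^ 2 := by
  rw [Phi_plus, sq]
  unfold Phi
  rw [← sum_prod_mul]
  refine Finset.sum_congr rfl fun st _ => ?_
  unfold fZ
  have e1 : D 0 st.1 * D 0 st.2 * (D 1 st.1 * D 1 st.2) =
    (D 0 st.1 * D 1 st.1) * (D 0 st.2 * D 1 st.2) := by ring
  have e2 : D 1 st.1 * D 0 st.2 * (D 0 st.1 * D 1 st.2) =
    (D 0 st.1 * D 1 st.1) * (D 0 st.2 * D 1 st.2) := by ring
  rw [e1, e2, Real.sqrt_mul (mul_nonneg (h.nn _ _) (h.nn _ _))]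
  ring

lemma T_minus : Phi fT (minusD D) = (Phi fT D) ^ 2 := by
  rw [Phi_minus, sq]
  unfold Phi
  rw [← sum_prod_mul]
  refine Finset.sum_congr rfl fun st _ => ?_
  unfold fT
  rw [← abs_mul]
  congr 1
  ring

lemma two_term_bound (h : IsLaw D) (f : ℝ → ℝ → ℝ) (F : ℝ)
    (hF : F = ∑ st : S × S, (f (D 0 st.1) (D 1 st.1) * (D 0 st.2 + D 1 st.2) +
      (D 0 st.1 + D 1 st.1) * f (D 0 st.2) (D 1 st.2) -
      f (D 0 st.1) (D 1 st.1) * f (D 0 st.2) (D 1 st.2))) :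
    F = 2 * Phi f D - Phi f D ^ 2 := by
  have hs := h.sum
  unfold Phi fS at hs
  rw [hF, Finset.sum_sub_distrib, Finset.sum_add_distrib,
    sum_prod_mul (fun s => f (D 0 s) (D 1 s)) (fun s => D 0 s + D 1 s),
    sum_prod_mul (fun s => D 0 s + D 1 s) (fun s => f (D 0 s) (D 1 s)),
    sum_prod_mul (fun s => f (D 0 s) (D 1 s)) (fun s => f (D 0 s) (D 1 s)), hs]
  unfold Phi
  ring

lemma Z_minus (h : IsLaw D) : Phi fZ (minusD D) ≤ 2 * Phi fZ D - (Phi fZ D) ^ 2 := by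
  rw [Phi_minus, ← two_term_bound h fZ _ rfl]
  refine Finset.sum_le_sum fun st _ => ?_
  unfold fZ
  obtain ⟨a, ha, ea⟩ : ∃ a, 0 ≤ a ∧ D 0 st.1 = a ^ 2 :=
    ⟨_, Real.sqrt_nonneg _, (Real.sq_sqrt (h.nn _ _)).symm⟩
  obtain ⟨b, hb, eb⟩ : ∃ a, 0 ≤ a ∧ D 1 st.1 = a ^ 2 :=
    ⟨_, Real.sqrt_nonneg _, (Real.sq_sqrt (h.nn _ _)).symm⟩
  obtain ⟨c, hc, ec⟩ : ∃ a, 0 ≤ a ∧ D 0 st.2 = a ^ 2 :=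
    ⟨_, Real.sqrt_nonneg _, (Real.sq_sqrt (h.nn _ _)).symm⟩
  obtain ⟨d, hd, ed⟩ : ∃ a, 0 ≤ a ∧ D 1 st.2 = a ^ 2 :=
    ⟨_, Real.sqrt_nonneg _, (Real.sq_sqrt (h.nn _ _)).symm⟩
  rw [ea, eb, ec, ed, ← mul_pow a b, ← mul_pow c d, Real.sqrt_sq (mul_nonneg ha hb),
    Real.sqrt_sq (mul_nonneg hc hd)]
  have key : Real.sqrt ((a ^ 2 * c ^ 2 + b ^ 2 * d ^ 2) * (b ^ 2 * c ^ 2 + a ^ 2 * d ^ 2)) ≤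
      a * b * (c ^ 2 + d ^ 2) + (a ^ 2 + b ^ 2) * (c * d) - 2 * (a * b) * (c * d) := by
    apply Real.sqrt_le_iff.2
    constructor
    · have : 0 ≤ (a - b) ^ 2 * (c * d) := by positivity
      have : 0 ≤ a * b * (c ^ 2 + d ^ 2) := by positivity
      nlinarith
    · have : 0 ≤ 2 * (a * b * (c * d)) * ((a - b) ^ 2 * (c - d) ^ 2) := by positivity
      nlinarith
  linarith

lemma T_plus (h : IsLaw D) : Phi fT (plusD D) ≤ 2 * Phi fT D - (Phi fT D) ^ 2 := by
  rw [Phi_plus, ← two_term_bound h fT _ rfl]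
  refine Finset.sum_le_sum fun st _ => ?_
  unfold fT
  have ha := h.nn 0 st.1
  have hb := h.nn 1 st.1
  have hc := h.nn 0 st.2
  have hd := h.nn 1 st.2
  generalize D 0 st.1 = a at *
  generalize D 1 st.1 = b at *
  generalize D 0 st.2 = c at *
  generalize D 1 st.2 = d at *
  have := mul_nonneg ha hc
  have := mul_nonneg ha hd
  have := mul_nonneg hb hc
  have := mul_nonneg hb hd
  rcases abs_cases (a - b) with ⟨h1, _⟩ | ⟨h1, _⟩ <;>
  rcases abs_cases (c - d) with ⟨h2, _⟩ | ⟨h2, _⟩ <;>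
  rcases abs_cases (a * c - b * d) with ⟨h3, _⟩ | ⟨h3, _⟩ <;>
  rcases abs_cases (b * c - a * d) with ⟨h4, _⟩ | ⟨h4, _⟩ <;>
  rw [h1, h2, h3, h4] <;> nlinarith

lemma Z_T_add (h : IsLaw D) : 1 ≤ Phi fZ D + Phi fT D := by
  rw [← h.sum]
  unfold Phi
  rw [← Finset.sum_add_distrib]
  refine Finset.sum_le_sum fun s _ => ?_
  unfold fZ fT fS
  have ha := h.nn 0 s
  have hb := h.nn 1 s
  generalize D 0 s = a at *
  generalize D 1 s = b at *
  rcases le_total a b with hab | hab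
  · have : a ≤ Real.sqrt (a * b) := Real.le_sqrt_of_sq_le (by nlinarith)
    rw [abs_of_nonpos (by linarith)]; linarith
  · have : b ≤ Real.sqrt (a * b) := Real.le_sqrt_of_sq_le (by nlinarith)
    rw [abs_of_nonneg (by linarith)]; linarith

lemma Z_nonneg : 0 ≤ Phi fZ D := Finset.sum_nonneg fun s _ => by unfold fZ; positivity

lemma T_nonneg : 0 ≤ Phi fT D := Finset.sum_nonneg fun s _ => by unfold fT; positivity

lemma Z_T_sq (h : IsLaw D) : (Phi fZ D) ^ 2 + (Phi fT D) ^ 2 ≤ 1 := by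
  set Z := Phi fZ D with hZ
  set T := Phi fT D with hT
  set R := Real.sqrt (Z ^ 2 + T ^ 2) with hR
  have hR2 : R ^ 2 = Z ^ 2 + T ^ 2 := Real.sq_sqrt (by positivity)
  have hR0 : 0 ≤ R := Real.sqrt_nonneg _
  have key : Z ^ 2 + T ^ 2 ≤ R * 1 := by
    rw [← h.sum]
    have e : Z ^ 2 + T ^ 2 = ∑ s, (Z * fZ (D 0 s) (D 1 s) + T * fT (D 0 s) (D 1 s)) := by
      rw [Finset.sum_add_distrib, ← Finset.mul_sum, ← Finset.mul_sum]
      rw [show ∑ s, fZ (D 0 s) (D 1 s) = Z from rfl, show ∑ s, fT (D 0 s) (D 1 s) = T from rfl]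
      ring
    rw [e]
    unfold Phi
    rw [Finset.mul_sum]
    refine Finset.sum_le_sum fun s _ => ?_
    have ha := h.nn 0 s
    have hb := h.nn 1 s
    unfold fZ fT fS
    generalize D 0 s = a at *
    generalize D 1 s = b at *
    have q := Real.sq_sqrt (mul_nonneg ha hb)
    have q2 := sq_abs (a - b)
    generalize Real.sqrt (a * b) = x at *
    generalize |a - b| = y at *
    have p : (2 * x) ^ 2 + y ^ 2 = (a + b) ^ 2 := by rw [mul_pow, q, q2]; ring
    apply le_of_sq_le_sq _ (mul_nonneg hR0 (add_nonneg ha hb))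
    rw [mul_pow, hR2, ← p]
    nlinarith [sq_nonneg (Z * y - T * (2 * x))]
  rw [← hR2] at key ⊢
  have : R ≤ 1 := by
    by_contra hc
    push Not at hc
    nlinarith
  nlinarith

lemma eta_mul (x y : ℝ) : eta (x * y) = y * eta x + x * eta y := by
  have := Real.negMulLog_mul x y
  unfold Real.negMulLog at this
  unfold eta Real.logb
  have h2 : Real.log 2 ≠ 0 := (Real.log_pos (by norm_num)).ne'
  field_simp
  linarith

lemma H_step (h : IsLaw D) : Phi fH (minusD D) + Phi fH (plusD D) = 2 * Phi fH D := by
  have hs := h.sum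
  unfold Phi fS at hs
  rw [Phi_minus, Phi_plus, ← Finset.sum_add_distrib]
  have : ∀ st : S × S, fH (D 0 st.1 * D 0 st.2 + D 1 st.1 * D 1 st.2)
      (D 1 st.1 * D 0 st.2 + D 0 st.1 * D 1 st.2) + (fH (D 0 st.1 * D 0 st.2) (D 1 st.1 * D 1 st.2) +
      fH (D 1 st.1 * D 0 st.2) (D 0 st.1 * D 1 st.2)) =
      fH (D 0 st.1) (D 1 st.1) * (D 0 st.2 + D 1 st.2) +
      (D 0 st.1 + D 1 st.1) * fH (D 0 st.2) (D 1 st.2) := by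
    intro st
    unfold fH
    have e : D 0 st.1 * D 0 st.2 + D 1 st.1 * D 1 st.2 + (D 1 st.1 * D 0 st.2 + D 0 st.1 * D 1 st.2)
      = (D 0 st.1 + D 1 st.1) * (D 0 st.2 + D 1 st.2) := by ring
    rw [e, eta_mul, eta_mul (D 0 st.1) (D 0 st.2), eta_mul (D 1 st.1) (D 1 st.2),
      eta_mul (D 1 st.1) (D 0 st.2), eta_mul (D 0 st.1) (D 1 st.2)]
    ring
  simp_rw [this]
  rw [Finset.sum_add_distrib,
    sum_prod_mul (fun s => fH (D 0 s) (D 1 s)) (fun s => D 0 s + D 1 s),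
    sum_prod_mul (fun s => D 0 s + D 1 s) (fun s => fH (D 0 s) (D 1 s)), hs]
  unfold Phi
  ring

/-- `x log (x+y)/x` style identity -/
lemma fH_eq {a b : ℝ} (ha : 0 < a) (hb : 0 < b) :
    fH a b * Real.log 2 = a * Real.log (1 + b / a) + b * Real.log (1 + a / b) := by
  have h2 : Real.log 2 ≠ 0 := (Real.log_pos (by norm_num)).ne'
  have e1 : 1 + b / a = (a + b) / a := by field_simp
  have e2 : 1 + a / b = (a + b) / b := by field_simp; ring
  rw [e1, e2, Real.log_div (by positivity) ha.ne', Real.log_div (by positivity) hb.ne']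
  unfold fH eta Real.logb
  field_simp
  ring

lemma fH_zero_left (b : ℝ) : fH 0 b = 0 := by simp [fH, eta]
lemma fH_zero_right (b : ℝ) : fH b 0 = 0 := by simp [fH, eta]

lemma log_one_add_le {x : ℝ} (hx : 0 ≤ x) : Real.log (1 + x) ≤ 2 * Real.sqrt x := by
  have hs := Real.sqrt_nonneg x
  have h1 : 1 + x ≤ (1 + Real.sqrt x) ^ 2 := by nlinarith [Real.sq_sqrt hx]
  calc Real.log (1 + x) ≤ Real.log ((1 + Real.sqrt x) ^ 2) := Real.log_le_log (by linarith) h1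
    _ = 2 * Real.log (1 + Real.sqrt x) := by rw [Real.log_pow]; norm_num
    _ ≤ 2 * Real.sqrt x := by
      have := Real.log_le_sub_one_of_pos (show 0 < 1 + Real.sqrt x by linarith)
      linarith

lemma mul_log_le {a b : ℝ} (ha : 0 < a) (hb : 0 < b) :
    a * Real.log (1 + b / a) ≤ 2 * Real.sqrt (a * b) := by
  have h := mul_le_mul_of_nonneg_left (log_one_add_le (div_pos hb ha).le) ha.le
  refine h.trans (le_of_eq ?_)
  have : a * b = a ^ 2 * (b / a) := by field_simp
  rw [this, Real.sqrt_mul (by positivity), Real.sqrt_sq ha.le]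
  ring

lemma fH_le {a b : ℝ} (ha : 0 ≤ a) (hb : 0 ≤ b) : fH a b ≤ (2 / Real.log 2) * fZ a b := by
  have hl : 0 < Real.log 2 := Real.log_pos (by norm_num)
  rcases ha.eq_or_lt with rfl | ha
  · rw [fH_zero_left]; unfold fZ; positivity
  rcases hb.eq_or_lt with rfl | hb
  · rw [fH_zero_right]; unfold fZ; positivity
  have h1 := mul_log_le ha hb
  have h2 := mul_log_le hb ha
  rw [mul_comm b a] at h2
  have h3 := fH_eq ha hb
  unfold fZ
  rw [div_mul_eq_mul_div, le_div_iff₀ hl, h3]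
  linarith

lemma fH_nonneg {a b : ℝ} (ha : 0 ≤ a) (hb : 0 ≤ b) : 0 ≤ fH a b := by
  have hl : 0 < Real.log 2 := Real.log_pos (by norm_num)
  rcases ha.eq_or_lt with rfl | ha
  · rw [fH_zero_left]
  rcases hb.eq_or_lt with rfl | hb
  · rw [fH_zero_right]
  have h3 := fH_eq ha hb
  have h1 : 0 ≤ Real.log (1 + b / a) := Real.log_nonneg (by linarith [div_pos hb ha])
  have h2 : 0 ≤ Real.log (1 + a / b) := Real.log_nonneg (by linarith [div_pos ha hb])
  have : 0 ≤ fH a b * Real.log 2 := by rw [h3]; positivity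
  exact nonneg_of_mul_nonneg_left this hl

/-- `fH a b ≤ a + b` -/
lemma fH_le_add {a b : ℝ} (ha : 0 ≤ a) (hb : 0 ≤ b) : fH a b ≤ a + b := by
  have hl : 0 < Real.log 2 := Real.log_pos (by norm_num)
  rcases ha.eq_or_lt with rfl | ha
  · rw [fH_zero_left]; linarith
  rcases hb.eq_or_lt with rfl | hb
  · rw [fH_zero_right]; linarith
  have h3 := fH_eq ha hb
  -- log ((a+b)/a) ≤ log 2 + ((a+b)/(2a) - 1)
  have k : ∀ x y : ℝ, 0 < x → 0 < y → x * Real.log (1 + y / x) ≤ x * Real.log 2 + (y - x) / 2 := by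
    intro x y hx hy
    have e : 1 + y / x = 2 * ((x + y) / (2 * x)) := by field_simp
    have hp : 0 < (x + y) / (2 * x) := by positivity
    have := Real.log_le_sub_one_of_pos hp
    rw [e, Real.log_mul (by norm_num) hp.ne', mul_add]
    have := mul_le_mul_of_nonneg_left this hx.le
    have e2 : x * ((x + y) / (2 * x) - 1) = (y - x) / 2 := by field_simp; ring
    linarith
  have h1 := k a b ha hb
  have h2 := k b a hb ha
  have : fH a b * Real.log 2 ≤ (a + b) * Real.log 2 := by rw [h3]; linarith
  exact le_of_mul_le_mul_right this hl

/-- `2 min ≤ fH` -/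
lemma fH_ge {a b : ℝ} (ha : 0 ≤ a) (hb : 0 ≤ b) : a + b - |a - b| ≤ fH a b := by
  have hl : 0 < Real.log 2 := Real.log_pos (by norm_num)
  rcases ha.eq_or_lt with rfl | ha
  · rw [fH_zero_left]; simp [abs_of_nonneg hb]
  rcases hb.eq_or_lt with rfl | hb
  · rw [fH_zero_right]; simp [abs_of_pos ha]
  have h3 := fH_eq ha hb
  -- for x ≤ y : x log(1+y/x) ≥ x log 2 and y log (1+x/y) ≥ x log 2
  have k : ∀ x y : ℝ, 0 < x → x ≤ y → 2 * x * Real.log 2 ≤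
      x * Real.log (1 + y / x) + y * Real.log (1 + x / y) := by
    intro x y hx hxy
    have hy : 0 < y := by linarith
    have h1 : Real.log 2 ≤ Real.log (1 + y / x) := Real.log_le_log (by norm_num) (by
      have : 1 ≤ y / x := by rw [le_div_iff₀ hx]; linarith
      linarith)
    have h2 : x * Real.log 2 ≤ y * Real.log (1 + x / y) := by
      have B : (1 : ℝ) + (y / x) * (x / y) ≤ (1 + x / y) ^ (y / x) := by
        apply one_add_mul_self_le_rpow_one_add
        · linarith [div_pos hx hy]
        · rw [le_div_iff₀ hx]; linarith
      have e : y / x * (x / y) = 1 := by field_simp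
      rw [e] at B
      have := Real.log_le_log (by norm_num) B
      rw [Real.log_rpow (by positivity)] at this
      have h4 := mul_le_mul_of_nonneg_left this hx.le
      have e2 : x * (y / x * Real.log (1 + x / y)) = y * Real.log (1 + x / y) := by field_simp
      rw [e2] at h4
      norm_num at h4
      exact h4
    have := mul_le_mul_of_nonneg_left h1 hx.le
    linarith
  have : (a + b - |a - b|) * Real.log 2 ≤ fH a b * Real.log 2 := by
    rw [h3]
    rcases le_total a b with hab | hab
    · rw [abs_of_nonpos (by linarith)]
      have := k a b ha hab
      linarith
    · rw [abs_of_nonneg (by linarith)]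
      have := k b a hb hab
      linarith
  exact le_of_mul_le_mul_right this hl

lemma H_nonneg (h : IsLaw D) : 0 ≤ Phi fH D :=
  Finset.sum_nonneg fun s _ => fH_nonneg (h.nn _ _) (h.nn _ _)

lemma H_le_one (h : IsLaw D) : Phi fH D ≤ 1 := by
  rw [← h.sum]
  exact Finset.sum_le_sum fun s _ => fH_le_add (h.nn _ _) (h.nn _ _)

lemma H_le_Z (h : IsLaw D) : Phi fH D ≤ (2 / Real.log 2) * Phi fZ D := by
  unfold Phi
  rw [Finset.mul_sum]
  exact Finset.sum_le_sum fun s _ => fH_le (h.nn _ _) (h.nn _ _)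

lemma H_ge_T (h : IsLaw D) : 1 - Phi fT D ≤ Phi fH D := by
  rw [← h.sum]
  unfold Phi
  rw [← Finset.sum_sub_distrib]
  exact Finset.sum_le_sum fun s _ => fH_ge (h.nn _ _) (h.nn _ _)

end

/-! ### Random variables -/

section
variable {Ω Ω' 𝒱' : Type*} [Fintype Ω] [Fintype Ω'] [Fintype 𝒱] [Fintype 𝒱']

/-- joint law of `T` and `V` -/
def JD (p : Ω → ℝ) (T : Ω → ZMod 2) (V : Ω → 𝒱) : ZMod 2 → 𝒱 → ℝ :=
  fun b v => dist p (fun ω => (T ω, V ω)) (b, v)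

lemma ZB_eq (p : Ω → ℝ) (T : Ω → ZMod 2) (V : Ω → 𝒱) : ZB p T V = Phi fZ (JD p T V) := by
  unfold ZB Phi fZ JD
  rw [Finset.mul_sum]

lemma dist_nonneg' {p : Ω → ℝ} (hp : ∀ ω, 0 ≤ p ω) (X : Ω → α) (a : α) : 0 ≤ dist p X a :=
  Finset.sum_nonneg fun ω _ => by split_ifs <;> simp [hp]

lemma sum_dist [Fintype α] (p : Ω → ℝ) (X : Ω → α) : ∑ a, dist p X a = ∑ ω, p ω := by
  unfold dist
  rw [Finset.sum_comm]
  simp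

lemma dist_isPMF [Fintype α] {p : Ω → ℝ} (hp : IsPMF p) (X : Ω → α) : IsPMF (dist p X) :=
  ⟨fun a => dist_nonneg' hp.1 X a, by rw [sum_dist, hp.2]⟩

lemma dist_comp (p : Ω → ℝ) (π : Ω → Ω') (X : Ω' → α) (a : α) :
    dist p (fun ω => X (π ω)) a = dist (dist p π) X a := by
  unfold dist
  have : ∀ x : Ω', (if X x = a then ∑ ω, (if π ω = x then p ω else 0) else 0) =
      ∑ ω, if π ω = x then (if X x = a then p ω else 0) else 0 := by
    intro x
    by_cases h : X x = a <;> simp [h]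
  simp_rw [this]
  rw [Finset.sum_comm]
  simp

lemma dist_equiv (p : Ω → ℝ) (e : Ω' ≃ Ω) (X : Ω → α) (a : α) :
    dist p X a = dist (fun ω => p (e ω)) (fun ω => X (e ω)) a := by
  unfold dist
  exact (Equiv.sum_comp e (fun ω => if X ω = a then p ω else 0)).symm

lemma dist_eq_zero (p : Ω → ℝ) (X : Ω → α) (a : α) (h : ∀ ω, X ω ≠ a) : dist p X a = 0 :=
  Finset.sum_eq_zero fun ω _ => if_neg (h ω)

/-- Sums over values only depend on the partition generated by the variable. -/
lemma sum_kernel {γ γ' : Type*} [Fintype γ] [Fintype γ'] (V : Ω → γ) (V' : Ω → γ')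
    (h : ∀ ω ω', V ω = V ω' ↔ V' ω = V' ω') (F : γ → ℝ) (F' : γ' → ℝ)
    (hF : ∀ v, (∀ ω, V ω ≠ v) → F v = 0) (hF' : ∀ v, (∀ ω, V' ω ≠ v) → F' v = 0)
    (hFF : ∀ ω, F (V ω) = F' (V' ω)) : ∑ v, F v = ∑ v, F' v := by
  have e1 : ∑ v, F v = ∑ v ∈ Finset.univ.image V, F v := by
    symm
    apply Finset.sum_subset (Finset.subset_univ _)
    intro v _ hv
    apply hF
    intro ω hω
    exact hv (by simp [← hω])
  have e2 : ∑ v, F' v = ∑ v ∈ Finset.univ.image V', F' v := by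
    symm
    apply Finset.sum_subset (Finset.subset_univ _)
    intro v _ hv
    apply hF'
    intro ω hω
    exact hv (by simp [← hω])
  rcases isEmpty_or_nonempty Ω with hΩ | hΩ
  · rw [Finset.sum_eq_zero (fun v _ => hF v (fun ω => isEmptyElim ω)),
      Finset.sum_eq_zero (fun v _ => hF' v (fun ω => isEmptyElim ω))]
  rw [e1, e2]
  have ch : ∀ v ∈ Finset.univ.image V, ∃ ω, V ω = v := by
    intro v hv
    simpa using hv
  choose! g hg using ch
  refine Finset.sum_bij (fun v _ => V' (g v)) ?_ ?_ ?_ ?_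
  · intro v hv; simp
  · intro v hv w hw hvw
    have := (h _ _).2 hvw
    rw [hg v hv, hg w hw] at this
    exact this
  · intro v hv
    obtain ⟨ω, -, rfl⟩ := Finset.mem_image.1 hv
    refine ⟨V ω, by simp, ?_⟩
    exact (h _ _).1 (hg (V ω) (by simp))
  · intro v hv
    rw [← hFF, hg v hv]

lemma dist_kernel {γ γ' : Type*} (p : Ω → ℝ) (V : Ω → γ) (V' : Ω → γ')
    (h : ∀ ω ω', V ω = V ω' ↔ V' ω = V' ω') (ω : Ω) : dist p V (V ω) = dist p V' (V' ω) := by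
  unfold dist
  refine Finset.sum_congr rfl fun ω' _ => ?_
  by_cases h1 : V ω' = V ω
  · rw [if_pos h1, if_pos ((h _ _).1 h1)]
  · rw [if_neg h1, if_neg (fun h2 => h1 ((h _ _).2 h2))]

lemma Phi_kernel (φ : ℝ → ℝ → ℝ) (hφ : φ 0 0 = 0) (p : Ω → ℝ) (T : Ω → ZMod 2)
    (V : Ω → 𝒱) (V' : Ω → 𝒱') (h : ∀ ω ω', V ω = V ω' ↔ V' ω = V' ω') :
    Phi φ (JD p T V) = Phi φ (JD p T V') := by
  unfold Phi JD
  refine sum_kernel V V' h _ _ ?_ ?_ ?_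
  · intro v hv
    rw [dist_eq_zero, dist_eq_zero, hφ]
    · exact fun ω hω => hv ω (congrArg Prod.snd hω)
    · exact fun ω hω => hv ω (congrArg Prod.snd hω)
  · intro v hv
    rw [dist_eq_zero, dist_eq_zero, hφ]
    · exact fun ω hω => hv ω (congrArg Prod.snd hω)
    · exact fun ω hω => hv ω (congrArg Prod.snd hω)
  · intro ω
    have : ∀ b, dist p (fun ω => (T ω, V ω)) (b, V ω) = dist p (fun ω => (T ω, V' ω)) (b, V' ω) := by
      intro b
      unfold dist
      refine Finset.sum_congr rfl fun ω' _ => ?_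
      simp only [Prod.mk.injEq, h]
    rw [this, this]

lemma H_kernel {γ γ' : Type*} [Fintype γ] [Fintype γ'] (p : Ω → ℝ) (V : Ω → γ) (V' : Ω → γ')
    (h : ∀ ω ω', V ω = V ω' ↔ V' ω = V' ω') : H p V = H p V' := by
  unfold H
  refine sum_kernel V V' h _ _ ?_ ?_ ?_
  · intro v hv
    rw [dist_eq_zero p V v hv]; simp
  · intro v hv
    rw [dist_eq_zero p V' v hv]; simp
  · intro ω
    rw [dist_kernel p V V' h ω]

lemma JD_law {p : Ω → ℝ} (hp : IsPMF p) (T : Ω → ZMod 2) (V : Ω → 𝒱) : IsLaw (JD p T V) where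
  nn b s := dist_nonneg' hp.1 _ _
  sum := by
    have := (dist_isPMF hp (fun ω => (T ω, V ω))).2
    rw [Fintype.sum_prod_type, sum_zmod2, ← Finset.sum_add_distrib] at this
    exact this

/-- `Phi fH` is the conditional entropy -/
lemma Phi_fH (p : Ω → ℝ) (T : Ω → ZMod 2) (V : Ω → 𝒱) :
    Phi fH (JD p T V) = condH p T V := by
  unfold Phi condH H fH
  rw [Fintype.sum_prod_type, sum_zmod2, ← Finset.sum_add_distrib, ← Finset.sum_sub_distrib]
  refine Finset.sum_congr rfl fun v _ => ?_
  have : JD p T V 0 v + JD p T V 1 v = dist p V v := by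
    unfold JD dist
    rw [← Finset.sum_add_distrib]
    refine Finset.sum_congr rfl fun ω _ => ?_
    have : T ω = 0 ∨ T ω = 1 := by
      generalize T ω = x
      revert x; decide
    rcases this with h | h <;> simp [h]
  rw [this]
  rfl

/-- two independent copies -/
def p2 (p : Ω → ℝ) : Ω × Ω → ℝ := fun w => p w.1 * p w.2

lemma JD_plus (p : Ω → ℝ) (T : Ω → ZMod 2) (V : Ω → 𝒱) :
    JD (p2 p) (fun w => T w.2) (fun w => (T w.1 + T w.2, (V w.1, V w.2))) = plusD (JD p T V) := by
  funext b w
  obtain ⟨u, s, t⟩ := w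
  unfold plusD JD dist p2
  simp only
  refine Eq.trans ?_ (sum_prod_mul _ _)
  refine Finset.sum_congr rfl fun w _ => ?_
  have key : ∀ x y u b : ZMod 2, (y = b ∧ x + y = u) ↔ (x = u + b ∧ y = b) := by decide
  have := key (T w.1) (T w.2) u b
  by_cases h2 : (T w.1, V w.1) = (u + b, s)
  · by_cases h3 : (T w.2, V w.2) = (b, t)
    · have g2 := Prod.mk.inj h2
      have g3 := Prod.mk.inj h3
      have g1 := this.2 ⟨g2.1, g3.1⟩
      rw [if_pos h2, if_pos h3, if_pos]
      rw [g1.2, g1.1, g2.2, g3.2]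
    · rw [if_neg h3, mul_zero, if_neg]
      intro h4
      simp only [Prod.mk.injEq] at h3 h4
      exact h3 ⟨h4.1, h4.2.2.2⟩
  · rw [if_neg h2, zero_mul, if_neg]
    intro h4
    simp only [Prod.mk.injEq] at h2 h4
    exact h2 ⟨(this.1 ⟨h4.1, h4.2.1⟩).1, h4.2.2.1⟩

lemma JD_minus (p : Ω → ℝ) (T : Ω → ZMod 2) (V : Ω → 𝒱) :
    JD (p2 p) (fun w => T w.1 + T w.2) (fun w => (V w.1, V w.2)) = minusD (JD p T V) := by
  funext u st
  obtain ⟨s, t⟩ := st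
  have h := fun b => congrFun (congrFun (JD_plus p T V) b) (u, (s, t))
  have h0 := h 0
  have h1 := h 1
  unfold plusD at h0 h1
  simp only [add_zero] at h0 h1
  unfold minusD
  simp only
  rw [← h0, ← h1]
  unfold JD dist
  rw [← Finset.sum_add_distrib]
  refine Finset.sum_congr rfl fun w _ => ?_
  have : T w.2 = 0 ∨ T w.2 = 1 := by
    generalize T w.2 = x
    revert x; decide
  rcases this with h | h <;> simp [h]

end

/-! ### The polar transform of an i.i.d. block -/

section
variable {S A : Type*} [Fintype S] [Fintype A]

def gc (n i j : ℕ) : Prop := ∀ k < n, Nat.testBit i k → Nat.testBit j (n - 1 - k)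

lemma gc_even_lo (n i j : ℕ) : gc (n + 1) (2 * i) j ↔ gc n i j := by
  unfold gc
  constructor
  · intro h k hk hi
    have := h (k + 1) (by omega) (by rw [Nat.testBit_succ]; simpa using hi)
    rwa [show n + 1 - 1 - (k + 1) = n - 1 - k by omega] at this
  · intro h k hk hi
    rcases k with _ | k
    · simp at hi
    · rw [Nat.testBit_succ] at hi
      have := h k (by omega) (by simpa using hi)
      rwa [show n + 1 - 1 - (k + 1) = n - 1 - k by omega]

lemma gc_odd_lo (n i j : ℕ) : gc (n + 1) (2 * i + 1) j ↔ Nat.testBit j n ∧ gc n i j := by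
  unfold gc
  constructor
  · intro h
    refine ⟨?_, fun k hk hi => ?_⟩
    · have := h 0 (by omega) (by simp)
      simpa using this
    · have := h (k + 1) (by omega) (by rw [Nat.testBit_succ, show (2 * i + 1) / 2 = i by omega]; exact hi)
      rwa [show n + 1 - 1 - (k + 1) = n - 1 - k by omega] at this
  · intro h k hk hi
    rcases k with _ | k
    · simpa using h.1
    · rw [Nat.testBit_succ, show (2 * i + 1) / 2 = i by omega] at hi
      have := h.2 k (by omega) hi
      rwa [show n + 1 - 1 - (k + 1) = n - 1 - k by omega]

lemma gc_shift (n i j : ℕ) : gc n i (2 ^ n + j) ↔ gc n i j := by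
  unfold gc
  refine forall_congr' fun k => forall_congr' fun hk => ?_
  rw [Nat.testBit_two_pow_add_gt (by omega)]

/-- the polar-transformed bit -/
def Un (n i : ℕ) (ω : Fin (2 ^ n) → ZMod 2 × S) : ZMod 2 :=
  ∑ j, (ω j).1 * (if gc n i j.val then 1 else 0)

def Vn (n i : ℕ) (ω : Fin (2 ^ n) → ZMod 2 × S) : (Fin i → ZMod 2) × (Fin (2 ^ n) → S) :=
  (fun k => Un n k.val ω, fun j => (ω j).2)

def cp (P : A → ℝ) (n : ℕ) (ω : Fin (2 ^ n) → A) : ℝ := ∏ j, P (ω j)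

def spl (n : ℕ) : Fin (2 ^ n) ⊕ Fin (2 ^ n) ≃ Fin (2 ^ (n + 1)) :=
  finSumFinEquiv.trans (finCongr (by rw [pow_succ]; ring))

lemma spl_inl (n : ℕ) (j : Fin (2 ^ n)) : (spl n (Sum.inl j)).val = j.val := by simp [spl]
lemma spl_inr (n : ℕ) (j : Fin (2 ^ n)) : (spl n (Sum.inr j)).val = 2 ^ n + j.val := by simp [spl, add_comm]

def spw (n : ℕ) : (Fin (2 ^ n) → A) × (Fin (2 ^ n) → A) ≃ (Fin (2 ^ (n + 1)) → A) :=
  (Equiv.sumArrowEquivProdArrow _ _ _).symm.trans (Equiv.arrowCongr (spl n) (Equiv.refl _))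


lemma spw_inl (n : ℕ) (w : (Fin (2 ^ n) → A) × (Fin (2 ^ n) → A)) (j : Fin (2 ^ n)) :
    spw n w (spl n (Sum.inl j)) = w.1 j := by
  simp [spw, Equiv.arrowCongr, Equiv.sumArrowEquivProdArrow]


lemma spw_inr (n : ℕ) (w : (Fin (2 ^ n) → A) × (Fin (2 ^ n) → A)) (j : Fin (2 ^ n)) :
    spw n w (spl n (Sum.inr j)) = w.2 j := by
  simp [spw, Equiv.arrowCongr, Equiv.sumArrowEquivProdArrow]

lemma cp_spw (P : A → ℝ) (n : ℕ) (w : (Fin (2 ^ n) → A) × (Fin (2 ^ n) → A)) :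
    cp P (n + 1) (spw n w) = p2 (cp P n) w := by
  unfold cp p2
  rw [← Equiv.prod_comp (spl n), Fintype.prod_sum_type]
  simp only [spw_inl, spw_inr]

lemma Un_even (n i : ℕ) (w : (Fin (2 ^ n) → ZMod 2 × S) × (Fin (2 ^ n) → ZMod 2 × S)) :
    Un (n + 1) (2 * i) (spw n w) = Un n i w.1 + Un n i w.2 := by
  unfold Un
  rw [← Equiv.sum_comp (spl n), Fintype.sum_sum_type]
  simp only [spw_inl, spw_inr, spl_inl, spl_inr, gc_even_lo, gc_shift]

lemma Un_odd (n i : ℕ) (w : (Fin (2 ^ n) → ZMod 2 × S) × (Fin (2 ^ n) → ZMod 2 × S)) :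
    Un (n + 1) (2 * i + 1) (spw n w) = Un n i w.2 := by
  unfold Un
  rw [← Equiv.sum_comp (spl n), Fintype.sum_sum_type]
  have h1 : ∀ j : Fin (2 ^ n), Nat.testBit j.val n = false := fun j => Nat.testBit_lt_two_pow j.2
  have h2 : ∀ j : Fin (2 ^ n), Nat.testBit (2 ^ n + j.val) n = true := fun j => by
    rw [Nat.testBit_two_pow_add_eq, h1]; rfl
  simp only [spw_inl, spw_inr, spl_inl, spl_inr, gc_odd_lo, gc_shift, h1, h2]
  simp

lemma Vn_eq (n i : ℕ) (ω ω' : Fin (2 ^ n) → ZMod 2 × S) : Vn n i ω = Vn n i ω' ↔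
    (∀ k < i, Un n k ω = Un n k ω') ∧ ∀ j, (ω j).2 = (ω' j).2 := by
  unfold Vn
  rw [Prod.mk.injEq, funext_iff, funext_iff, Fin.forall_iff]

lemma snd_eq (n : ℕ) (w w' : (Fin (2 ^ n) → ZMod 2 × S) × (Fin (2 ^ n) → ZMod 2 × S)) :
    (∀ j, (spw n w j).2 = (spw n w' j).2) ↔
      (∀ j, (w.1 j).2 = (w'.1 j).2) ∧ ∀ j, (w.2 j).2 = (w'.2 j).2 := by
  rw [← (spl n).forall_congr_right, Sum.forall]
  simp only [spw_inl, spw_inr]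

lemma forall_lt_two_mul (i : ℕ) (Q : ℕ → Prop) :
    (∀ k < 2 * i, Q k) ↔ ∀ k < i, Q (2 * k) ∧ Q (2 * k + 1) := by
  constructor
  · intro h k hk
    exact ⟨h _ (by omega), h _ (by omega)⟩
  · intro h k hk
    rcases Nat.even_or_odd' k with ⟨c, rfl | rfl⟩
    · exact (h c (by omega)).1
    · exact (h c (by omega)).2

lemma Vn_even (n i : ℕ) (w w' : (Fin (2 ^ n) → ZMod 2 × S) × (Fin (2 ^ n) → ZMod 2 × S)) :
    Vn (n + 1) (2 * i) (spw n w) = Vn (n + 1) (2 * i) (spw n w') ↔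
      (Vn n i w.1, Vn n i w.2) = (Vn n i w'.1, Vn n i w'.2) := by
  rw [Vn_eq, snd_eq, forall_lt_two_mul, Prod.mk.injEq, Vn_eq, Vn_eq]
  simp only [Un_even, Un_odd]
  constructor
  · rintro ⟨h, h1, h2⟩
    refine ⟨⟨fun k hk => ?_, h1⟩, fun k hk => (h k hk).2, h2⟩
    have := (h k hk).1
    rw [(h k hk).2] at this
    exact add_right_cancel this
  · rintro ⟨⟨h1, h2⟩, h3, h4⟩
    exact ⟨fun k hk => ⟨by rw [h1 k hk, h3 k hk], h3 k hk⟩, h2, h4⟩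

lemma Vn_odd (n i : ℕ) (w w' : (Fin (2 ^ n) → ZMod 2 × S) × (Fin (2 ^ n) → ZMod 2 × S)) :
    Vn (n + 1) (2 * i + 1) (spw n w) = Vn (n + 1) (2 * i + 1) (spw n w') ↔
      (Un n i w.1 + Un n i w.2, (Vn n i w.1, Vn n i w.2)) =
      (Un n i w'.1 + Un n i w'.2, (Vn n i w'.1, Vn n i w'.2)) := by
  rw [Vn_eq, Prod.mk.injEq, ← Vn_even, Vn_eq, ← Un_even, ← Un_even]
  simp only [Nat.lt_succ_iff_lt_or_eq]
  constructor
  · rintro ⟨h, h1⟩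
    exact ⟨h _ (Or.inr rfl), fun k hk => h k (Or.inl hk), h1⟩
  · rintro ⟨h, h1, h2⟩
    refine ⟨fun k hk => ?_, h2⟩
    rcases hk with hk | rfl
    · exact h1 k hk
    · exact h

lemma JD_equiv {Ω Ω' 𝒱 : Type*} [Fintype Ω] [Fintype Ω'] (p : Ω → ℝ) (e : Ω' ≃ Ω)
    (T : Ω → ZMod 2) (V : Ω → 𝒱) :
    JD p T V = JD (fun ω => p (e ω)) (fun ω => T (e ω)) (fun ω => V (e ω)) := by
  funext b v
  exact dist_equiv p e _ _

/-- the law at node `(n,i)` -/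
def ND (P : ZMod 2 × S → ℝ) (n i : ℕ) : ZMod 2 → (Fin i → ZMod 2) × (Fin (2 ^ n) → S) → ℝ :=
  JD (cp P n) (Un n i) (Vn n i)

lemma ND_even (φ : ℝ → ℝ → ℝ) (hφ : φ 0 0 = 0) (P : ZMod 2 × S → ℝ) (n i : ℕ) :
    Phi φ (ND P (n + 1) (2 * i)) = Phi φ (minusD (ND P n i)) := by
  unfold ND
  rw [← JD_minus, JD_equiv _ (spw n)]
  simp only [cp_spw, Un_even]
  exact Phi_kernel φ hφ _ _ _ _ (Vn_even n i)

lemma ND_odd (φ : ℝ → ℝ → ℝ) (hφ : φ 0 0 = 0) (P : ZMod 2 × S → ℝ) (n i : ℕ) :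
    Phi φ (ND P (n + 1) (2 * i + 1)) = Phi φ (plusD (ND P n i)) := by
  unfold ND
  rw [← JD_plus, JD_equiv _ (spw n)]
  simp only [cp_spw, Un_odd]
  exact Phi_kernel φ hφ _ _ _ _ (Vn_odd n i)

lemma cp_pmf {P : A → ℝ} (hP : IsPMF P) (n : ℕ) : IsPMF (cp P n) := by
  refine ⟨fun ω => Finset.prod_nonneg fun j _ => hP.1 _, ?_⟩
  unfold cp
  rw [← Fintype.prod_sum (fun (_ : Fin (2 ^ n)) a => P a)]
  simp [hP.2]

lemma ND_law {P : ZMod 2 × S → ℝ} (hP : IsPMF P) (n i : ℕ) : IsLaw (ND P n i) :=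
  JD_law (cp_pmf hP n) _ _

lemma ND_zero (φ : ℝ → ℝ → ℝ) (hφ : φ 0 0 = 0) (P : ZMod 2 × S → ℝ) :
    Phi φ (ND P 0 0) = Phi φ (JD P Prod.fst Prod.snd) := by
  unfold ND
  rw [JD_equiv (cp P 0) (Equiv.funUnique (Fin 1) (ZMod 2 × S)).symm]
  have h1 : (fun ω => cp P 0 ((Equiv.funUnique (Fin 1) (ZMod 2 × S)).symm ω)) = P := by
    funext ω
    simp [cp]
  have h2 : (fun ω => Un 0 0 ((Equiv.funUnique (Fin 1) (ZMod 2 × S)).symm ω)) = Prod.fst := by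
    funext ω
    simp [Un, gc]
  rw [h1, h2]
  refine Phi_kernel φ hφ _ _ _ _ fun ω ω' => ?_
  rw [Vn_eq]
  simp

theorem ND_fractions {P : ZMod 2 × S → ℝ} (hP : IsPMF P) (β : ℝ) (hβ0 : 0 < β)
    (hβ : β < 1 / 2) :
    Tendsto (fun n => Ev n (fun i => if Phi fZ (ND P n i) < deltaN β n then 1 else 0)) atTop
      (𝓝 (1 - condH P Prod.fst Prod.snd)) ∧
    Tendsto (fun n => Ev n (fun i => if 1 - deltaN β n < Phi fZ (ND P n i) then 1 else 0)) atTop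
      (𝓝 (condH P Prod.fst Prod.snd)) := by
  have hl := ND_law hP
  have z0 : fZ 0 0 = 0 := by simp [fZ]
  have t0 : fT 0 0 = 0 := by simp [fT]
  have h0 : fH 0 0 = 0 := fH_zero_left 0
  have PP : PolPair (fun n i => Phi fZ (ND P n i)) (fun n i => Phi fT (ND P n i)) :=
    { z0 := fun n i => Z_nonneg
      t0 := fun n i => T_nonneg
      sq := fun n i => Z_T_sq (hl n i)
      add := fun n i => Z_T_add (hl n i)
      zp := fun n i => by rw [ND_odd _ z0, Z_plus (hl n i)]
      zm := fun n i => by rw [ND_even _ z0]; exact Z_minus (hl n i)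
      tm := fun n i => by rw [ND_even _ t0, T_minus]
      tp := fun n i => by rw [ND_odd _ t0]; exact T_plus (hl n i) }
  refine PP.fractions (h := fun n i => Phi fH (ND P n i)) β hβ0 hβ _ (2 / Real.log 2)
    (div_nonneg (by norm_num) (Real.log_nonneg (by norm_num))) ?_ (fun n i => H_nonneg (hl n i))
    (fun n i => H_le_one (hl n i)) (fun n i => H_le_Z (hl n i)) (fun n i => H_ge_T (hl n i))
  intro n
  induction n with
  | zero =>
    rw [← Phi_fH, ← ND_zero fH h0]
    simp [Ev]
  | succ n ih =>
    rw [Ev_succ, ← ih]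
    congr 1
    funext i
    rw [ND_even _ h0, ND_odd _ h0, H_step (hl n i)]
    ring

end
/-! ### Translation to the multilevel construction -/

section
variable {A B S Ω Ω' : Type*} [Fintype S] [Fintype A] [Fintype B] [Fintype Ω] [Fintype Ω']

lemma cp_dist (P : A → ℝ) (g : A → B) (n : ℕ) :
    dist (cp P n) (fun ω j => g (ω j)) = cp (dist P g) n := by
  funext v
  unfold cp dist
  rw [Fintype.prod_sum]
  refine Finset.sum_congr rfl fun ω _ => ?_
  by_cases h : (fun j => g (ω j)) = v
  · rw [if_pos h]
    refine Finset.prod_congr rfl fun j _ => ?_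
    rw [if_pos (congrFun h j)]
  · rw [if_neg h]
    obtain ⟨j, hj⟩ := Function.ne_iff.1 h
    symm
    exact Finset.prod_eq_zero (Finset.mem_univ j) (if_neg hj)

lemma JD_comp {𝒱 : Type*} (p : Ω → ℝ) (π : Ω → Ω') (T : Ω' → ZMod 2) (V : Ω' → 𝒱) :
    JD p (fun ω => T (π ω)) (fun ω => V (π ω)) = JD (dist p π) T V := by
  funext b v
  exact dist_comp p π (fun x => (T x, V x)) (b, v)

lemma H_comp [Fintype α] (p : Ω → ℝ) (π : Ω → Ω') (X : Ω' → α) :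
    H (dist p π) X = H p (fun ω => X (π ω)) := by
  unfold H
  simp only [dist_comp]

end

section
variable [Fintype 𝒳] [Fintype 𝒴] {q : ℕ}

def π1 (f : (Fin q → ZMod 2) ≃ 𝒳) (l : Fin q) (a : 𝒳 × 𝒴) :
    ZMod 2 × (({k : Fin q // k < l} → ZMod 2) × 𝒴) :=
  (f.symm a.1 l, (fun k => f.symm a.1 k.1, a.2))

def PL (PX : 𝒳 → ℝ) (W : 𝒳 → 𝒴 → ℝ) (f : (Fin q → ZMod 2) ≃ 𝒳) (l : Fin q) :
    ZMod 2 × (({k : Fin q // k < l} → ZMod 2) × 𝒴) → ℝ :=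
  dist (slP PX W) (π1 f l)

lemma slP_pmf {PX : 𝒳 → ℝ} {W : 𝒳 → 𝒴 → ℝ} (hPX : IsPMF PX) (hW : IsChannel W) :
    IsPMF (slP PX W) := by
  refine ⟨fun a => mul_nonneg (hPX.1 _) (hW.1 _ _), ?_⟩
  unfold slP
  rw [Fintype.sum_prod_type]
  simp [← Finset.mul_sum, hW.2, hPX.2]

lemma PL_pmf {PX : 𝒳 → ℝ} {W : 𝒳 → 𝒴 → ℝ} (hPX : IsPMF PX) (hW : IsChannel W)
    (f : (Fin q → ZMod 2) ≃ 𝒳) (l : Fin q) : IsPMF (PL PX W f l) :=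
  dist_isPMF (slP_pmf hPX hW) _

lemma Ubit_eq (f : (Fin q → ZMod 2) ≃ 𝒳) (n : ℕ) (l : Fin q) (i : Fin (2 ^ n))
    (ω : Fin (2 ^ n) → 𝒳 × 𝒴) :
    Ubit f n (fun j => (ω j).1) l i = Un n i.val (fun j => π1 f l (ω j)) := by
  unfold Ubit Un Bbit GN π1 gc
  refine Finset.sum_congr rfl fun j _ => ?_
  congr

lemma ZBout_eq (PX : 𝒳 → ℝ) (W : 𝒳 → 𝒴 → ℝ) (f : (Fin q → ZMod 2) ≃ 𝒳) (n : ℕ) (l : Fin q)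
    (i : Fin (2 ^ n)) : ZBout PX W f n l i = Phi fZ (ND (PL PX W f l) n i.val) := by
  unfold ZBout ND PL
  rw [ZB_eq, JD_equiv _ (Equiv.arrowProdEquivProdArrow (Fin (2 ^ n)) (fun _ => 𝒳) (fun _ => 𝒴)),
    ← cp_dist, ← JD_comp]
  have h1 : (fun ω => codeP PX W n
      ((Equiv.arrowProdEquivProdArrow (Fin (2 ^ n)) (fun _ => 𝒳) (fun _ => 𝒴)) ω)) =
      cp (slP PX W) n := by
    funext ω
    unfold codeP cp slP
    rw [← Finset.prod_mul_distrib]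
    rfl
  rw [h1]
  have h2 : (fun ω => Ubit f n ((Equiv.arrowProdEquivProdArrow (Fin (2 ^ n)) (fun _ => 𝒳)
      (fun _ => 𝒴)) ω).1 l i) = fun ω => Un n i.val (fun j => π1 f l (ω j)) := by
    funext ω
    exact Ubit_eq f n l i ω
  rw [h2]
  refine Phi_kernel fZ (by simp [fZ]) _ _ _ _ fun ω ω' => ?_
  rw [Vn_eq]
  have e1 : ∀ ω : Fin (2 ^ n) → 𝒳 × 𝒴, ((Equiv.arrowProdEquivProdArrow (Fin (2 ^ n)) (fun _ => 𝒳)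
      (fun _ => 𝒴)) ω) = (fun j => (ω j).1, fun j => (ω j).2) := fun ω => rfl
  simp only [e1, Vval, Prod.mk.injEq, Ubit_eq, funext_iff, Subtype.forall, π1, Bbit]
  constructor
  · rintro ⟨⟨h1, h2⟩, h3⟩
    exact ⟨fun k hk => h1 ⟨k, hk.trans i.2⟩ hk, fun j => ⟨h2 j, h3 j⟩⟩
  · rintro ⟨h1, h2⟩
    exact ⟨⟨fun k hk => h1 k.val hk, fun j => (h2 j).1⟩, fun j => (h2 j).2⟩

def Wtriv : 𝒳 → Unit → ℝ := fun _ _ => 1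

lemma Wtriv_channel : IsChannel (Wtriv : 𝒳 → Unit → ℝ) :=
  ⟨fun _ _ => zero_le_one, fun _ => by simp [Wtriv]⟩

lemma ZBplain_eq (PX : 𝒳 → ℝ) (f : (Fin q → ZMod 2) ≃ 𝒳) (n : ℕ) (l : Fin q)
    (i : Fin (2 ^ n)) : ZBplain PX f n l i = ZBout PX Wtriv f n l i := by
  unfold ZBplain ZBout
  rw [ZB_eq, ZB_eq, JD_equiv (codeP PX Wtriv n)
    (Equiv.prodUnique (Fin (2 ^ n) → 𝒳) (Fin (2 ^ n) → Unit)).symm]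
  have h1 : (fun ω => codeP PX Wtriv n
      ((Equiv.prodUnique (Fin (2 ^ n) → 𝒳) (Fin (2 ^ n) → Unit)).symm ω)) = codeX PX n := by
    funext ω
    simp [codeP, codeX, Wtriv]
  rw [h1]
  refine Phi_kernel fZ (by simp [fZ]) _ _ _ _ fun ω ω' => ?_
  simp

lemma chain_rule (PX : 𝒳 → ℝ) (W : 𝒳 → 𝒴 → ℝ) (f : (Fin q → ZMod 2) ≃ 𝒳) :
    ∑ l, condH (PL PX W f l) Prod.fst Prod.snd = condH (slP PX W) Prod.fst Prod.snd := by
  set h : ℕ → ℝ := fun m => H (slP PX W)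
    (fun a => ((fun k : {k : Fin q // k.val < m} => f.symm a.1 k.1), a.2)) with hh
  have hl : ∀ l : Fin q, condH (PL PX W f l) Prod.fst Prod.snd = h (l.val + 1) - h l.val := by
    intro l
    unfold condH PL
    rw [H_comp, H_comp]
    congr 1
    refine H_kernel _ _ _ fun ω ω' => ?_
    simp only [π1, Prod.mk.injEq, funext_iff, Subtype.forall, Nat.lt_succ_iff_lt_or_eq]
    constructor
    · rintro ⟨h1, h2, h3⟩
      refine ⟨fun k hk => ?_, h3⟩
      rcases hk with hk | hk
      · exact h2 k hk
      · rw [Fin.ext hk]; exact h1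
    · rintro ⟨h1, h2⟩
      exact ⟨h1 l (Or.inr rfl), fun k hk => h1 k (Or.inl hk), h2⟩
  simp only [hl]
  rw [Fin.sum_univ_eq_sum_range (fun m => h (m + 1) - h m) q, Finset.sum_range_sub]
  unfold condH
  congr 1
  · refine H_kernel _ _ _ fun ω ω' => ?_
    simp only [Prod.mk.injEq, funext_iff, Subtype.forall]
    constructor
    · rintro ⟨h1, h2⟩
      refine ⟨f.symm.injective (funext fun k => h1 k k.2), h2⟩
    · rintro ⟨h1, h2⟩
      exact ⟨fun k _ => by rw [h1], h2⟩
  · refine H_kernel _ _ _ fun ω ω' => ?_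
    simp [funext_iff]

lemma H_fst {PX : 𝒳 → ℝ} {W : 𝒳 → 𝒴 → ℝ} (hW : IsChannel W) :
    H (slP PX W) Prod.fst = H PX id := by
  unfold H
  have : ∀ a, dist (slP PX W) Prod.fst a = dist PX id a := by
    intro a
    unfold dist slP
    rw [Fintype.sum_prod_type]
    refine Finset.sum_congr rfl fun x _ => ?_
    by_cases h : x = a
    · simp [h, ← Finset.mul_sum, hW.2]
    · simp [h]
  simp only [this]

lemma MI_eq {PX : 𝒳 → ℝ} {W : 𝒳 → 𝒴 → ℝ} (hW : IsChannel W) :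
    MI (slP PX W) Prod.fst Prod.snd = H PX id - condH (slP PX W) Prod.fst Prod.snd := by
  unfold MI condH
  rw [H_fst hW]
  ring

lemma condH_triv {PX : 𝒳 → ℝ} (hPX : IsPMF PX) :
    condH (slP PX (Wtriv : 𝒳 → Unit → ℝ)) Prod.fst Prod.snd = H PX id := by
  unfold condH
  rw [← H_fst (Wtriv_channel), H_kernel _ (fun ω : 𝒳 × Unit => (ω.1, ω.2)) Prod.fst (by simp)]
  have : H (slP PX (Wtriv : 𝒳 → Unit → ℝ)) Prod.snd = 0 := by
    unfold H
    have h1 : dist (slP PX (Wtriv : 𝒳 → Unit → ℝ)) Prod.snd () = 1 := by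
      unfold dist
      rw [← (slP_pmf hPX Wtriv_channel).2]
      simp
    simp [h1]
  rw [this, sub_zero]

end
/-! ### Degradation -/

section
variable {S S' : Type*} [Fintype S] [Fintype S']

def Ux (n i : ℕ) (x : Fin (2 ^ n) → ZMod 2) : ZMod 2 :=
  ∑ j, x j * (if gc n i j.val then 1 else 0)

lemma ND_explicit (P : ZMod 2 × S → ℝ) (n i : ℕ) (b : ZMod 2) (u : Fin i → ZMod 2)
    (s : Fin (2 ^ n) → S) : ND P n i b (u, s) =
      ∑ x : Fin (2 ^ n) → ZMod 2, if Ux n i x = b ∧ (fun k : Fin i => Ux n k.val x) = u then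
        ∏ j, P (x j, s j) else 0 := by
  unfold ND JD
  rw [dist_equiv _ (Equiv.arrowProdEquivProdArrow (Fin (2 ^ n)) (fun _ => ZMod 2) (fun _ => S)).symm]
  unfold dist
  rw [Fintype.sum_prod_type]
  refine Finset.sum_congr rfl fun x _ => ?_
  rw [Finset.sum_eq_single s]
  · by_cases h : Ux n i x = b ∧ (fun k : Fin i => Ux n k.val x) = u
    · rw [if_pos h, if_pos]
      · rfl
      · rw [Prod.mk.injEq]
        exact ⟨h.1, Prod.ext h.2 rfl⟩
    · rw [if_neg h, if_neg]
      intro h1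
      rw [Prod.mk.injEq] at h1
      exact h ⟨h1.1, congrArg Prod.fst h1.2⟩
  · intro s' _ hs
    rw [if_neg]
    intro h1
    rw [Prod.mk.injEq] at h1
    exact hs (congrArg Prod.snd h1.2)
  · simp

lemma ND_degrade (P : ZMod 2 × S → ℝ) (P' : ZMod 2 × S' → ℝ) (K : S → S' → ℝ)
    (h : ∀ b s', P' (b, s') = ∑ s, P (b, s) * K s s') (n i : ℕ) (b : ZMod 2) (u : Fin i → ZMod 2)
    (s' : Fin (2 ^ n) → S') :
    ND P' n i b (u, s') = ∑ s, ND P n i b (u, s) * ∏ j, K (s j) (s' j) := by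
  simp only [ND_explicit]
  simp only [Finset.sum_mul]
  rw [Finset.sum_comm]
  refine Finset.sum_congr rfl fun x _ => ?_
  split_ifs with hx
  · simp only [h]
    rw [Fintype.prod_sum]
    simp only [Finset.prod_mul_distrib]
  · simp

lemma Z_degrade (P : ZMod 2 × S → ℝ) (P' : ZMod 2 × S' → ℝ) (hP : IsPMF P) (K : S → S' → ℝ)
    (hK : IsChannel K)
    (h : ∀ b s', P' (b, s') = ∑ s, P (b, s) * K s s') (n i : ℕ) :
    Phi fZ (ND P n i) ≤ Phi fZ (ND P' n i) := by
  unfold Phi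
  rw [Fintype.sum_prod_type, Fintype.sum_prod_type]
  refine Finset.sum_le_sum fun u _ => ?_
  have nn := (ND_law hP n i).nn
  have kn : ∀ (s : Fin (2 ^ n) → S) (s' : Fin (2 ^ n) → S'), 0 ≤ ∏ j, K (s j) (s' j) :=
    fun s s' => Finset.prod_nonneg fun j _ => hK.1 _ _
  have ks : ∀ s : Fin (2 ^ n) → S, ∑ s' : Fin (2 ^ n) → S', ∏ j, K (s j) (s' j) = 1 := by
    intro s
    rw [← Fintype.prod_sum (fun j a => K (s j) a)]
    simp [hK.2]
  calc ∑ s, fZ (ND P n i 0 (u, s)) (ND P n i 1 (u, s))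
      = ∑ s' : Fin (2 ^ n) → S', ∑ s, fZ (ND P n i 0 (u, s)) (ND P n i 1 (u, s)) *
          ∏ j, K (s j) (s' j) := by
        rw [Finset.sum_comm]
        simp only [← Finset.mul_sum, ks, mul_one]
    _ ≤ _ := by
        refine Finset.sum_le_sum fun s' _ => ?_
        rw [ND_degrade P P' K h, ND_degrade P P' K h]
        unfold fZ
        rw [Real.sqrt_mul (Finset.sum_nonneg fun s _ => mul_nonneg (nn _ _) (kn _ _))]
        refine le_trans (le_of_eq ?_) (mul_le_mul_of_nonneg_left
          (Real.sum_sqrt_mul_sqrt_le Finset.univ (fun s => mul_nonneg (nn _ _) (kn s s'))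
            (fun s => mul_nonneg (nn _ _) (kn s s'))) zero_le_two)
        rw [Finset.mul_sum]
        refine Finset.sum_congr rfl fun s _ => ?_
        rw [← Real.sqrt_mul (mul_nonneg (nn _ _) (kn s s')), mul_assoc]
        congr 1
        rw [show ND P n i 0 (u, s) * (∏ j, K (s j) (s' j)) *
          (ND P n i 1 (u, s) * ∏ j, K (s j) (s' j)) =
          (ND P n i 0 (u, s) * ND P n i 1 (u, s)) * (∏ j, K (s j) (s' j)) ^ 2 by ring,
          Real.sqrt_mul (mul_nonneg (nn _ _) (nn _ _)), Real.sqrt_sq (kn s s')]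

end

section
variable [Fintype 𝒳] [Fintype 𝒴] [Fintype 𝒵] {q : ℕ}

lemma PL_explicit (PX : 𝒳 → ℝ) (W : 𝒳 → 𝒴 → ℝ) (f : (Fin q → ZMod 2) ≃ 𝒳) (l : Fin q)
    (b : ZMod 2) (v : {k : Fin q // k < l} → ZMod 2) (y : 𝒴) :
    PL PX W f l (b, (v, y)) =
      ∑ x, if f.symm x l = b ∧ (fun k : {k : Fin q // k < l} => f.symm x k.1) = v then
        PX x * W x y else 0 := by
  unfold PL dist slP
  rw [Fintype.sum_prod_type]
  refine Finset.sum_congr rfl fun x _ => ?_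
  rw [Finset.sum_eq_single y]
  · by_cases h : f.symm x l = b ∧ (fun k : {k : Fin q // k < l} => f.symm x k.1) = v
    · rw [if_pos h, if_pos]
      unfold π1
      rw [← h.1, ← h.2]
    · rw [if_neg h, if_neg]
      intro h1
      exact h ⟨congrArg Prod.fst h1, congrArg (fun z => z.2.1) h1⟩
  · intro s' _ hs
    rw [if_neg]
    intro h1
    exact hs (congrArg (fun z => z.2.2) h1)
  · simp

lemma ZBout_degraded {PX : 𝒳 → ℝ} (hPX : IsPMF PX) {W₁ : 𝒳 → 𝒴 → ℝ} {W₂ : 𝒳 → 𝒵 → ℝ}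
    (hW₁ : IsChannel W₁) (hdeg : Degraded W₂ W₁) (f : (Fin q → ZMod 2) ≃ 𝒳) (n : ℕ) (l : Fin q)
    (i : Fin (2 ^ n)) : ZBout PX W₁ f n l i ≤ ZBout PX W₂ f n l i := by
  obtain ⟨Wt, hWt, hd⟩ := hdeg
  rw [ZBout_eq, ZBout_eq]
  refine Z_degrade _ _ (PL_pmf hPX hW₁ f l)
    (fun s s' => if s.1 = s'.1 then Wt s.2 s'.2 else 0) ⟨?_, ?_⟩ ?_ n i.val
  · intro s s'
    dsimp only
    split_ifs
    · exact hWt.1 _ _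
    · exact le_rfl
  · rintro ⟨v, y⟩
    rw [Fintype.sum_prod_type]
    dsimp only
    rw [Finset.sum_eq_single v]
    · simp [hWt.2]
    · intro v' _ hv
      simp [Ne.symm hv]
    · simp
  · rintro b ⟨v, z⟩
    rw [Fintype.sum_prod_type, Finset.sum_eq_single v]
    · simp only [PL_explicit, if_true]
      simp only [Finset.sum_mul]
      rw [Finset.sum_comm]
      refine Finset.sum_congr rfl fun x _ => ?_
      split_ifs with hx
      · rw [hd, Finset.mul_sum]
        refine Finset.sum_congr rfl fun y _ => ?_
        ring
      · simp
    · intro v' _ hv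
      simp [hv]
    · simp

lemma triv_degraded {W : 𝒳 → 𝒴 → ℝ} (hW : IsChannel W) :
    Degraded (Wtriv : 𝒳 → Unit → ℝ) W :=
  ⟨fun _ _ => 1, ⟨fun _ _ => zero_le_one, fun _ => by simp⟩, fun x z => by
    simp [Wtriv, hW.2]⟩

/-! ### Counting -/

lemma ncard_div (n : ℕ) (Q : Fin q → ℕ → Prop) :
    (({a : Fin q × Fin (2 ^ n) | Q a.1 a.2.val}.ncard : ℕ) : ℝ) / 2 ^ n =
      ∑ l, Ev n (fun i => if Q l i then 1 else 0) := by
  unfold Ev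
  rw [← Finset.sum_div]
  congr 1
  rw [Set.ncard_eq_toFinset_card', Set.toFinset_setOf, Finset.card_filter]
  push_cast
  rw [Fintype.sum_prod_type]
  refine Finset.sum_congr rfl fun l _ => ?_
  rw [← Fin.sum_univ_eq_sum_range (fun i => if Q l i then (1 : ℝ) else 0)]

lemma lim_L {PX : 𝒳 → ℝ} (hPX : IsPMF PX) {W : 𝒳 → 𝒴 → ℝ} (hW : IsChannel W)
    (f : (Fin q → ZMod 2) ≃ 𝒳) (β : ℝ) (hβ0 : 0 < β) (hβ : β < 1 / 2) :
    Tendsto (fun n : ℕ => ((Lout PX W f β n).ncard : ℝ) / 2 ^ n) atTop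
      (𝓝 (q - condH (slP PX W) Prod.fst Prod.snd)) := by
  have e : ∀ n : ℕ, ((Lout PX W f β n).ncard : ℝ) / 2 ^ n =
      ∑ l, Ev n (fun i => if Phi fZ (ND (PL PX W f l) n i) < deltaN β n then 1 else 0) := by
    intro n
    rw [← ncard_div n (fun l i => Phi fZ (ND (PL PX W f l) n i) < deltaN β n)]
    simp only [Lout, ZBout_eq]
  simp only [e]
  have := tendsto_finsetSum Finset.univ
    (fun l _ => (ND_fractions (PL_pmf hPX hW f l) β hβ0 hβ).1)
  rw [Finset.sum_sub_distrib, chain_rule] at this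
  simpa using this

lemma lim_H {PX : 𝒳 → ℝ} (hPX : IsPMF PX) {W : 𝒳 → 𝒴 → ℝ} (hW : IsChannel W)
    (f : (Fin q → ZMod 2) ≃ 𝒳) (β : ℝ) (hβ0 : 0 < β) (hβ : β < 1 / 2) :
    Tendsto (fun n : ℕ => ((Hout PX W f β n).ncard : ℝ) / 2 ^ n) atTop
      (𝓝 (condH (slP PX W) Prod.fst Prod.snd)) := by
  have e : ∀ n : ℕ, ((Hout PX W f β n).ncard : ℝ) / 2 ^ n =
      ∑ l, Ev n (fun i => if 1 - deltaN β n < Phi fZ (ND (PL PX W f l) n i) then 1 else 0) := by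
    intro n
    rw [← ncard_div n (fun l i => 1 - deltaN β n < Phi fZ (ND (PL PX W f l) n i))]
    simp only [Hout, ZBout_eq]
  simp only [e]
  have := tendsto_finsetSum Finset.univ
    (fun l _ => (ND_fractions (PL_pmf hPX hW f l) β hβ0 hβ).2)
  rw [chain_rule] at this
  exact this

lemma ncard_compl_div (n : ℕ) (s : Set (Fin q × Fin (2 ^ n))) :
    ((sᶜ.ncard : ℕ) : ℝ) / 2 ^ n = q - (s.ncard : ℝ) / 2 ^ n := by
  have h := Set.ncard_add_ncard_compl s
  have h2 : Nat.card (Fin q × Fin (2 ^ n)) = q * 2 ^ n := by simp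
  rw [h2] at h
  have h3 : (s.ncard : ℝ) + (sᶜ.ncard : ℝ) = q * 2 ^ n := by exact_mod_cast h
  field_simp
  linarith

lemma ncard_split_div (n : ℕ) (s t : Set (Fin q × Fin (2 ^ n))) :
    (((s ∩ t).ncard : ℕ) : ℝ) / 2 ^ n = (s.ncard : ℝ) / 2 ^ n - ((s ∩ tᶜ).ncard : ℝ) / 2 ^ n := by
  have h := Set.ncard_inter_add_ncard_diff_eq_ncard s t
  rw [Set.diff_eq] at h
  have h3 : ((s ∩ t).ncard : ℝ) + ((s ∩ tᶜ).ncard : ℝ) = s.ncard := by exact_mod_cast h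
  field_simp
  linarith

lemma lim_D {PX : 𝒳 → ℝ} (hPX : IsPMF PX) {W : 𝒳 → 𝒴 → ℝ} (hW : IsChannel W)
    (f : (Fin q → ZMod 2) ≃ 𝒳) (β : ℝ) (hβ0 : 0 < β) (hβ : β < 1 / 2) :
    Tendsto (fun n : ℕ => ((Dset PX W f β n).ncard : ℝ) / 2 ^ n) atTop
      (𝓝 ((q : ℝ) - H PX (id : 𝒳 → 𝒳))) := by
  have hL := lim_L hPX (Wtriv_channel (𝒳 := 𝒳)) f β hβ0 hβ
  have hH := lim_H hPX (Wtriv_channel (𝒳 := 𝒳)) f β hβ0 hβ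
  rw [condH_triv hPX] at hL hH
  have hH' := hH.const_sub (q : ℝ)
  refine tendsto_of_tendsto_of_tendsto_of_le_of_le hL hH' (fun n => ?_) (fun n => ?_)
  · refine div_le_div_of_nonneg_right ?_ (by positivity)
    refine Nat.cast_le.2 (Set.ncard_le_ncard ?_ (Set.toFinite _))
    intro a ha
    have ha' : ZBout PX Wtriv f n a.1 a.2 < deltaN β n := ha
    refine ⟨lt_of_le_of_lt (ZBout_degraded hPX hW (triv_degraded hW) f n a.1 a.2) ha', ?_⟩
    intro hc
    have hc' : 1 - deltaN β n < ZBplain PX f n a.1 a.2 := hc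
    rw [ZBplain_eq] at hc'
    have := deltaN_le β hβ0 n
    linarith
  · dsimp only
    rw [← ncard_compl_div]
    refine div_le_div_of_nonneg_right ?_ (by positivity)
    refine Nat.cast_le.2 (Set.ncard_le_ncard ?_ (Set.toFinite _))
    intro a ha hc
    refine ha.2 ?_
    have hc' : 1 - deltaN β n < ZBout PX Wtriv f n a.1 a.2 := hc
    rw [← ZBplain_eq] at hc'
    exact hc'

lemma lim_R {PX : 𝒳 → ℝ} (hPX : IsPMF PX) {W : 𝒳 → 𝒴 → ℝ} (hW : IsChannel W)
    (f : (Fin q → ZMod 2) ≃ 𝒳) (β : ℝ) (hβ0 : 0 < β) (hβ : β < 1 / 2) :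
    Tendsto (fun n : ℕ => ((Rset PX W f β n).ncard : ℝ) / 2 ^ n) atTop
      (𝓝 (MI (slP PX W) Prod.fst Prod.snd)) := by
  have h := (lim_L hPX hW f β hβ0 hβ).sub (lim_D hPX hW f β hβ0 hβ)
  rw [MI_eq hW]
  have e : ∀ n : ℕ, ((Rset PX W f β n).ncard : ℝ) / 2 ^ n =
      ((Lout PX W f β n).ncard : ℝ) / 2 ^ n - ((Dset PX W f β n).ncard : ℝ) / 2 ^ n :=
    fun n => ncard_split_div n _ _
  simp only [e]
  convert h using 2
  ring

end

/-- **(Theorem 1) Polarization of the multilevel polar code for the degraded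
wiretap channel.**  Let `W₁ : 𝒳 → 𝒴` (Bob) and `W₂ : 𝒳 → 𝒵` (Eve) be DMCs with
common finite input alphabet `𝒳` of cardinality `2^q` (labeled by `f`), fixed
input distribution `P_X`, and `W₂ ⪯ W₁`.  Then, as `n → ∞` (with `N = 2^n`),
`|𝓕|/N → H(X|Y)`, `|𝓐|/N → I(X;Y) − I(X;Z)`, `|𝓡|/N → I(X;Z)` and
`|𝓓|/N → q − H(X)`, where `(X,Y) ∼ P_X·W₁` and `(X,Z) ∼ P_X·W₂`. -/
theorem wiretap_polarization {𝒳 𝒴 𝒵 : Type*} [Fintype 𝒳] [Fintype 𝒴] [Fintype 𝒵]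
    {q : ℕ} (f : (Fin q → ZMod 2) ≃ 𝒳) (PX : 𝒳 → ℝ) (hPX : IsPMF PX)
    (W₁ : 𝒳 → 𝒴 → ℝ) (W₂ : 𝒳 → 𝒵 → ℝ)
    (hW₁ : IsChannel W₁) (hW₂ : IsChannel W₂) (hdeg : Degraded W₂ W₁)
    (β : ℝ) (hβ0 : 0 < β) (hβ : β < 1 / 2) :
    Tendsto (fun n : ℕ => ((Fset PX W₁ f β n).ncard : ℝ) / 2 ^ n) atTop
        (𝓝 (condH (slP PX W₁) Prod.fst Prod.snd)) ∧
    Tendsto (fun n : ℕ => ((Aset PX W₁ W₂ f β n).ncard : ℝ) / 2 ^ n) atTop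
        (𝓝 (MI (slP PX W₁) Prod.fst Prod.snd - MI (slP PX W₂) Prod.fst Prod.snd)) ∧
    Tendsto (fun n : ℕ => ((Rset PX W₂ f β n).ncard : ℝ) / 2 ^ n) atTop
        (𝓝 (MI (slP PX W₂) Prod.fst Prod.snd)) ∧
    Tendsto (fun n : ℕ => ((Dset PX W₁ f β n).ncard : ℝ) / 2 ^ n) atTop
        (𝓝 ((q : ℝ) - H PX (id : 𝒳 → 𝒳))) := by
  have hR1 := lim_R hPX hW₁ f β hβ0 hβ
  have hR2 := lim_R hPX hW₂ f β hβ0 hβ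
  refine ⟨?_, ?_, hR2, lim_D hPX hW₁ f β hβ0 hβ⟩
  · have h := (lim_L hPX hW₁ f β hβ0 hβ).const_sub (q : ℝ)
    have e : ∀ n : ℕ, ((Fset PX W₁ f β n).ncard : ℝ) / 2 ^ n =
        q - ((Lout PX W₁ f β n).ncard : ℝ) / 2 ^ n := fun n => ncard_compl_div n _
    simp only [e]
    convert h using 2
    ring
  · have h := hR1.sub hR2
    refine h.congr fun n => ?_
    rw [← sub_div]
    congr 1
    have hsub : Rset PX W₂ f β n ⊆ Rset PX W₁ f β n := by
      intro a ha
      exact ⟨lt_of_le_of_lt (ZBout_degraded hPX hW₁ hdeg f n a.1 a.2) ha.1, ha.2⟩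
    have h1 := Set.ncard_diff_add_ncard_of_subset hsub (Set.toFinite _)
    have h2 : (((Rset PX W₁ f β n) \ (Rset PX W₂ f β n)).ncard : ℝ) +
        ((Rset PX W₂ f β n).ncard : ℝ) = ((Rset PX W₁ f β n).ncard : ℝ) := by exact_mod_cast h1
    have h3 : Aset PX W₁ W₂ f β n = (Rset PX W₁ f β n) \ (Rset PX W₂ f β n) := rfl
    rw [h3]
    linarith

end PolarWiretap

end
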